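/- Every finite weakly-top group is nilpotent, and hence is the direct product of weakly-top p-groups (its Sylow subgroups, each of which is weakly-top). -/

import Mathlib

def IsWeaklyTop (G : Type*) [Group G] : Prop :=
  ∀ H : Subgroup G, Nat.card (Abelianization H) ≤ Nat.card (Abelianization G)

open scoped commutatorElement
universe u v



/-- `L ≤ R` are subgroups with `[R, X] ≤ L`. -/
def CenPair {X : Type*} [Group X] (L R : Subgroup X) : Prop :=
  L ≤ R ∧ ∀ r ∈ R, ∀ x : X, ⁅r, x⁆ ∈ L

theorem CenPair.conj {X : Type*} [Group X] {L R : Subgroup X} (h : CenPair L R)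
    {S : Subgroup X} (hLS : L ≤ S) (hSR : S ≤ R) : S.Normal := by
  constructor
  intro n hn g
  have h1 : ⁅n⁻¹, g⁆ ∈ S := hLS (h.2 _ (hSR (S.inv_mem hn)) g)
  have h2 : n * ⁅n⁻¹, g⁆ = g * n * g⁻¹ := by simp [commutatorElement_def, mul_assoc]
  rw [← h2]
  exact S.mul_mem hn h1

theorem relIndex_split {X : Type*} [Group X] (L R K : Subgroup X) [L.Normal] (h : L ≤ R) :
    L.relIndex R = (L ⊔ (R ⊓ K)).relIndex R * (L ⊓ K).relIndex (R ⊓ K) := by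
  have h1 : L ≤ L ⊔ (R ⊓ K) := le_sup_left
  have h2 : L ⊔ (R ⊓ K) ≤ R := sup_le h inf_le_left
  rw [← Subgroup.relIndex_mul_relIndex L _ R h1 h2, Subgroup.relIndex_sup_left, mul_comm]
  congr 1
  rw [← Subgroup.inf_relIndex_right L, ← inf_assoc, inf_eq_left.2 h]

theorem mem_of_pow_coprime {X : Type*} [Group X] [Finite X] (N : Subgroup X) [N.Normal]
    {x : X} {m : ℕ} (hx : x ^ m = 1) (hm : m.Coprime N.index) : x ∈ N := by
  have h1 : x ^ N.index ∈ N := Subgroup.pow_index_mem N x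
  rw [← QuotientGroup.eq_one_iff] at h1 ⊢
  have h2 : (x : X ⧸ N) ^ m = 1 := by rw [← QuotientGroup.mk_pow, hx]; rfl
  have h3 := orderOf_dvd_of_pow_eq_one h2
  have h4 : orderOf (x : X ⧸ N) ∣ N.index := orderOf_dvd_of_pow_eq_one (by simpa using h1)
  have := Nat.dvd_gcd h3 h4
  rw [hm] at this
  simpa using this

/-- decomposition of a finite nilpotent group -/
theorem nil_decomp {X : Type*} [Group X] [Finite X] [Group.IsNilpotent X] (p : ℕ) [Fact p.Prime]
    (P : Sylow p X) :
    ∃ H : Subgroup X, H.Normal ∧ (Nat.card H).Coprime p ∧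
      (∀ a ∈ P, ∀ b ∈ H, a * b = b * a) ∧ (P : Subgroup X) ⊔ H = ⊤ ∧
      (P : Subgroup X).IsComplement' H ∧
      (∀ x : X, (∃ k : ℕ, x ^ p ^ k = 1) → x ∈ P) := by
  classical
  have hcop : (Nat.card P).Coprime (P : Subgroup X).index := P.card_coprime_index
  obtain ⟨H, hH⟩ := Subgroup.exists_right_complement'_of_coprime (N := (P : Subgroup X)) hcop
  have hcardH : Nat.card H = (P : Subgroup X).index := hH.symm.index_eq_card.symm
  have hPn : (P : Subgroup X).Normal := inferInstance
  have hcard : (Nat.card H).Coprime p := by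
    rw [hcardH]
    exact ((Fact.out : p.Prime).coprime_iff_not_dvd.2 P.not_dvd_index).symm
  have hcC : (Nat.card H).Coprime (Subgroup.centralizer ((P : Subgroup X) : Set X)).index := by
    apply Nat.Coprime.symm
    rw [Nat.coprime_iff_gcd_eq_one]
    by_contra hne
    obtain ⟨r, hr, hrd⟩ := Nat.exists_prime_and_dvd hne
    have hr1 := hrd.trans (Nat.gcd_dvd_left _ _)
    have hr2 := hrd.trans (Nat.gcd_dvd_right _ _)
    have hrp : r ≠ p := by
      rintro rfl
      exact hr.one_lt.ne' (Nat.eq_one_of_dvd_coprimes hcard hr2 dvd_rfl)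
    have : Fact r.Prime := ⟨hr⟩
    obtain ⟨S⟩ : Nonempty (Sylow r X) := inferInstance
    have hSC : (S : Subgroup X) ≤ Subgroup.centralizer ((P : Subgroup X) : Set X) := by
      intro s hs
      rw [Subgroup.mem_centralizer_iff]
      intro g hg
      exact Subgroup.commute_of_normal_of_disjoint (P : Subgroup X) S hPn inferInstance
        (IsPGroup.disjoint_of_ne p r hrp.symm _ _ P.isPGroup' S.isPGroup') g s hg hs
    exact S.not_dvd_index (hr1.trans (Subgroup.index_dvd_of_le hSC))
  have hcomm : ∀ a ∈ P, ∀ b ∈ H, a * b = b * a := by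
    intro a ha b hb
    have hCn : (Subgroup.centralizer ((P : Subgroup X) : Set X)).Normal := inferInstance
    have hbC : b ∈ Subgroup.centralizer ((P : Subgroup X) : Set X) := by
      refine mem_of_pow_coprime _ (m := Nat.card H) ?_ hcC
      have := pow_card_eq_one' (x := (⟨b, hb⟩ : H))
      exact congrArg Subtype.val this
    exact Subgroup.mem_centralizer_iff.1 hbC a ha
  have hsup : (P : Subgroup X) ⊔ H = ⊤ := hH.sup_eq_top
  refine ⟨H, ?_, hcard, hcomm, hsup, hH, ?_⟩
  · constructor
    intro n hn g
    have hg : g ∈ (P : Subgroup X) ⊔ H := by rw [hsup]; trivial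
    obtain ⟨a, ha, b, hb, rfl⟩ := Subgroup.mem_sup_of_normal_left.1 hg
    have h1 : b * n * b⁻¹ ∈ H := H.mul_mem (H.mul_mem hb hn) (H.inv_mem hb)
    have h2 := hcomm a ha _ h1
    have : a * b * n * (a * b)⁻¹ = b * n * b⁻¹ := by
      have : a * b * n * (a * b)⁻¹ = a * (b * n * b⁻¹) * a⁻¹ := by group
      rw [this, h2]; group
    rw [this]; exact h1
  · rintro x ⟨k, hk⟩
    refine mem_of_pow_coprime _ hk ?_
    rw [← hcardH]
    exact (Nat.Coprime.pow_right k hcard).symm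


theorem exists_mem_comm_mem {P : Type*} [Group P] [Group.IsNilpotent P]
    (N K : Subgroup P) [K.Normal] (h : ¬ K ≤ N) :
    ∃ g ∈ K, g ∉ N ∧ ∀ x, ⁅g, x⁆ ∈ N := by
  classical
  have hex : ∃ n, ¬ (K ⊓ Subgroup.upperCentralSeries P n ≤ N) := by
    obtain ⟨n, hn⟩ := Group.IsNilpotent.nilpotent P
    refine ⟨n, ?_⟩
    rw [hn, inf_top_eq]; exact h
  have hmin := fun m => Nat.find_min (m := m) hex
  have hs := Nat.find_spec hex
  generalize Nat.find hex = n at hmin hs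
  cases n with
  | zero => simp at hs
  | succ n =>
    have h1 := hmin n (Nat.lt_succ_self n)
    rw [not_not] at h1
    obtain ⟨g, hg, hgN⟩ := SetLike.not_le_iff_exists.1 hs
    refine ⟨g, hg.1, hgN, fun x => h1 ⟨?_, ?_⟩⟩
    · have h2 : x * g⁻¹ * x⁻¹ ∈ K := Subgroup.Normal.conj_mem inferInstance _ (K.inv_mem hg.1) x
      have : ⁅g, x⁆ = g * (x * g⁻¹ * x⁻¹) := by simp [commutatorElement_def, mul_assoc]
      rw [this]
      exact K.mul_mem hg.1 h2
    · exact (Subgroup.mem_upperCentralSeries_succ_iff).1 hg.2 x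

theorem card_pow_le {A : Type*} [CommGroup A] [Finite A] (p : ℕ)
    (h : Nat.card (powMonoidHom p : A →* A).ker ≤ p) (k : ℕ) :
    Nat.card (powMonoidHom (p ^ k) : A →* A).ker ≤ p ^ k := by
  induction k with
  | zero =>
    have : (powMonoidHom (p ^ 0) : A →* A).ker = ⊥ := by
      ext x; simp [MonoidHom.mem_ker]
    rw [this]; simp
  | succ k ih =>
    set f := (powMonoidHom p : A →* A)
    set K := (powMonoidHom (p ^ (k+1)) : A →* A).ker
    have h1 : Nat.card (K.map f) ≤ p ^ k := by
      refine le_trans (Subgroup.card_le_of_le ?_) ih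
      rintro _ ⟨x, hx, rfl⟩
      simp only [K, SetLike.mem_coe, MonoidHom.mem_ker, powMonoidHom_apply, f] at hx ⊢
      rw [← pow_mul, ← hx, pow_succ, mul_comm]
    rw [← Subgroup.relIndex_ker] at h1
    have h2 : f.ker ≤ K := by
      intro x hx
      simp only [K, MonoidHom.mem_ker, powMonoidHom_apply, f] at hx ⊢
      rw [pow_succ, mul_comm, pow_mul, hx, one_pow]
    have h3 := Subgroup.card_mul_index (f.ker.subgroupOf K)
    rw [Nat.card_congr (Subgroup.subgroupOfEquivOfLe h2).toEquiv] at h3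
    rw [← h3, pow_succ, mul_comm]
    exact Nat.mul_le_mul h1 h

theorem pow_class_two {P : Type*} [Group P] {x y z : P} (hx : Commute z x) (hy : Commute z y)
    (h : y * x = z * (x * y)) (n : ℕ) :
    (x * y) ^ n = z ^ (n * (n - 1) / 2) * (x ^ n * y ^ n) := by
  have h1 : ∀ m : ℕ, y * x ^ m = z ^ m * (x ^ m * y) := by
    intro m
    induction m with
    | zero => simp
    | succ m ih =>
      rw [pow_succ x, ← mul_assoc, ih, mul_assoc, mul_assoc, h, ← mul_assoc (x ^ m) z,
        ← (hx.pow_right m).eq, pow_succ z]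
      simp only [mul_assoc]
  have h2 : ∀ m : ℕ, y ^ m * x = z ^ m * (x * y ^ m) := by
    intro m
    induction m with
    | zero => simp
    | succ m ih =>
      rw [pow_succ y, mul_assoc, h, ← mul_assoc, ← (hy.pow_right m).eq, mul_assoc,
        ← mul_assoc (y ^ m), ih, pow_succ z, ← mul_assoc, ← mul_assoc, ← pow_succ', ← pow_succ]
      simp only [mul_assoc]
  induction n with
  | zero => simp
  | succ n ih =>
    have h3 : (n + 1) * (n + 1 - 1) / 2 = n * (n - 1) / 2 + n := by
      have := Finset.sum_range_id_mul_two n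
      have h4 := Finset.sum_range_id_mul_two (n + 1)
      rw [Finset.sum_range_succ] at h4
      omega
    rw [pow_succ, ih, h3, pow_add]
    have h5 : x ^ n * y ^ n * (x * y) = z ^ n * (x ^ (n + 1) * y ^ (n + 1)) := by
      calc x ^ n * y ^ n * (x * y) = x ^ n * (y ^ n * x) * y := by simp only [mul_assoc]
        _ = (x ^ n * z ^ n) * (x * y ^ n) * y := by rw [h2]; simp only [mul_assoc]
        _ = _ := by
          rw [← ((hx.pow_right n).pow_left n).eq, pow_succ x, pow_succ y]; simp only [mul_assoc]
    rw [mul_assoc, h5, mul_assoc]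



theorem claimE {P : Type*} [Group P] (p : ℕ) [Fact p.Prime] (a0 : P)
    (hself : ∀ g, g * a0 = a0 * g → g ∈ Subgroup.zpowers a0)
    (hcomm : ∀ g h : P, ⁅g, h⁆ ∈ Subgroup.zpowers a0)
    (hO : ∀ a ∈ Subgroup.zpowers a0, a ^ p = 1 → a ∈ Subgroup.center P)
    (hs : ∀ a : P, a ^ p = 1 → (∀ x, ⁅a, x⁆ ∈ Subgroup.center P) → a ∈ Subgroup.center P)
    (g : P) (hg : g ∉ Subgroup.zpowers a0) (hz : ⁅g, a0⁆ ^ p = 1)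
    (hc : p ≠ 2 ∨ p = 2 ∧ ∃ c ∈ Subgroup.zpowers a0, Commute c g ∧ c ^ 2 = ⁅g, a0⁆) : False := by
  have hp : p.Prime := Fact.out
  obtain ⟨z, hzdef⟩ : ∃ z, z = ⁅g, a0⁆ := ⟨_, rfl⟩
  have hzA : z ∈ Subgroup.zpowers a0 := hzdef ▸ hcomm g a0
  rw [← hzdef] at hz hc
  have hzc : z ∈ Subgroup.center P := hO z hzA hz
  have hzcom : ∀ x, Commute z x := fun x => (Subgroup.mem_center_iff.1 hzc x).symm
  have hga : g * a0 = z * (a0 * g) := by rw [hzdef, commutatorElement_def]; group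
  have hz1 : z ≠ 1 := by
    rintro rfl
    exact hg (hself g (by simpa using hga))
  have hzo : orderOf z = p := orderOf_eq_prime hz hz1
  -- conjugation of powers
  have hconjpow : ∀ g' : P, g' * a0 = z * (a0 * g') → ∀ i : ℤ,
      g' * a0 ^ i = z ^ i * (a0 ^ i * g') := by
    intro g' h i
    have h1 : g' * a0 * g'⁻¹ = z * a0 := by rw [h]; group
    have h2 : g' * a0 ^ i * g'⁻¹ = z ^ i * a0 ^ i := by
      rw [← (hzcom a0).mul_zpow, ← h1, conj_zpow]
    rw [← mul_assoc, ← h2]; group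
  have hodd : p ≠ 2 → ∀ w : P, w ^ p = 1 → w ^ (p * (p - 1) / 2) = 1 := by
    intro h2 w hw
    have : p * (p - 1) / 2 = p * ((p - 1) / 2) := by
      have : 2 ∣ p - 1 := by
        rcases hp.eq_two_or_odd with h | h
        · exact absurd h h2
        · omega
      exact Nat.mul_div_assoc p this
    rw [this, pow_mul, hw, one_pow]
  -- g^p = a0^j
  have hgn : ∀ n : ℕ, g ^ n * a0 = z ^ n * (a0 * g ^ n) := by
    intro n
    induction n with
    | zero => simp
    | succ n ih =>
      rw [pow_succ, mul_assoc, hga, ← mul_assoc, ← ((hzcom (g ^ n))).eq, mul_assoc,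
        ← mul_assoc (g ^ n), ih, pow_succ' z]
      simp only [mul_assoc]
  obtain ⟨j, hj⟩ := hself (g ^ p) (by rw [hgn, hz, one_mul])
  simp only at hj
  have hzj : z ^ j = 1 := by
    have h1 := hconjpow g hga j
    rw [hj, ← pow_succ, ← pow_succ'] at h1
    exact (right_eq_mul.1 h1)
  have hpj : (p : ℤ) ∣ j := by
    rw [← hzo]; exact orderOf_dvd_iff_zpow_eq_one.2 hzj
  obtain ⟨m, rfl⟩ := hpj
  have key : ∃ g', g' ∉ Subgroup.zpowers a0 ∧ g' ^ p = 1 ∧ g' * a0 = z * (a0 * g') ∧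
      (p ≠ 2 ∨ p = 2 ∧ ∃ c ∈ Subgroup.zpowers a0, Commute c g' ∧ c ^ 2 = z) := by
    have h1 : g * a0 ^ (-m) = z ^ (-m) * (a0 ^ (-m) * g) := hconjpow g hga (-m)
    have h2 := pow_class_two (x := a0 ^ (-m)) (y := g) (z := z ^ (-m)) ((hzcom _).zpow_left _)
      ((hzcom _).zpow_left _) h1 p
    have h3 : (a0 ^ (-m)) ^ p * g ^ p = 1 := by
      rw [← hj, ← zpow_natCast, ← zpow_mul, ← zpow_add]
      convert zpow_zero a0 using 2; ring
    rw [h3, mul_one] at h2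
    have hgen : ∀ b ∈ Subgroup.zpowers a0, b * g ∉ Subgroup.zpowers a0 ∧
        (b * g) * a0 = z * (a0 * (b * g)) := by
      rintro _ ⟨i, rfl⟩
      constructor
      · intro h
        exact hg ((Subgroup.mul_mem_cancel_left (Subgroup.zpowers a0) (Subgroup.mem_zpowers_iff.2 ⟨i, rfl⟩)).1 h)
      · simp only
        rw [mul_assoc, hga, ← mul_assoc, ← (hzcom (a0 ^ i)).eq, mul_assoc, ← mul_assoc (a0 ^ i),
          (Commute.zpow_self a0 i).eq]
        simp only [mul_assoc]
    rcases hc with hc | ⟨hp2, c, hcA, hcg, hcz⟩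
    · refine ⟨a0 ^ (-m) * g, (hgen _ ⟨-m, rfl⟩).1, ?_, (hgen _ ⟨-m, rfl⟩).2, Or.inl hc⟩
      rw [h2]
      apply hodd hc
      rw [← zpow_natCast, ← zpow_mul, mul_comm, zpow_mul, zpow_natCast, hz, one_zpow]
    · subst hp2
      have hA : c ^ m * a0 ^ (-m) ∈ Subgroup.zpowers a0 :=
        Subgroup.mul_mem _ (Subgroup.zpow_mem _ hcA _) ⟨-m, rfl⟩
      have hca : Commute c a0 := by
        obtain ⟨i, rfl⟩ := hcA
        exact Commute.zpow_self a0 i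
      refine ⟨c ^ m * a0 ^ (-m) * g, (hgen _ hA).1, ?_, (hgen _ hA).2, Or.inr ⟨rfl, c, hcA, ?_, hcz⟩⟩
      · have hcomm2 : Commute (c ^ m) (a0 ^ (-m) * g) :=
          ((hca.zpow_right _).mul_right hcg).zpow_left _
        rw [mul_assoc, hcomm2.mul_pow, h2, ← zpow_natCast (c ^ m), ← zpow_mul, mul_comm m, zpow_mul,
          zpow_natCast, hcz]
        norm_num
      · exact (((Commute.refl c).zpow_right _).mul_right (hca.zpow_right _)).mul_right hcg
  obtain ⟨g', hg'A, hg'p, hg'a, hc'⟩ := key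
  have hcen : ∀ h : P, ⁅h, g'⁆ ∈ Subgroup.center P := by
    intro h
    obtain ⟨a, hadef⟩ : ∃ a, a = ⁅h, g'⁆ := ⟨_, rfl⟩
    have haA : a ∈ Subgroup.zpowers a0 := hadef ▸ hcomm h g'
    rw [← hadef]
    have hc1 : h * g' * h⁻¹ = a * g' := by rw [hadef, commutatorElement_def]; group
    have hc2 : (a * g') ^ p = 1 := by rw [← hc1, conj_pow, hg'p]; group
    obtain ⟨i, hi⟩ := haA
    simp only at hi
    have h3 : g' * a = z ^ i * (a * g') := by rw [← hi]; exact hconjpow g' hg'a i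
    rw [pow_class_two ((hzcom _).zpow_left _) ((hzcom _).zpow_left _) h3, hg'p, mul_one] at hc2
    have hzip : (z ^ i) ^ p = 1 := by
      rw [← zpow_natCast, ← zpow_mul, mul_comm, zpow_mul, zpow_natCast, hz, one_zpow]
    refine hO a ⟨i, hi⟩ ?_
    rcases hc' with hp2 | ⟨hp2, c, hcA, hcg, hcz⟩
    · rwa [hodd hp2 _ hzip, one_mul] at hc2
    · subst hp2
      have hzz : z⁻¹ = z := by rw [inv_eq_iff_mul_eq_one, ← pow_two, hz]
      norm_num at hc2
      rcases Int.even_or_odd i with he | ho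
      · obtain ⟨t, rfl⟩ := he
        rw [← two_mul, zpow_mul] at hc2
        rw [show z ^ (2 : ℤ) = 1 by exact_mod_cast hz] at hc2
        simpa using hc2
      · obtain ⟨t, rfl⟩ := ho
        have hz2 : z ^ (2 * t + 1) = z := by
          rw [zpow_add, zpow_mul, show z ^ (2 : ℤ) = 1 by exact_mod_cast hz]; simp
        rw [hz2] at hc2 h3
        have hac : Commute a c := by
          obtain ⟨l, rfl⟩ := hcA
          rw [← hi]
          exact Commute.zpow_zpow_self a0 _ _
        have h4 : (a * c⁻¹) ^ 2 = 1 := by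
          rw [hac.inv_right.mul_pow, inv_pow, hcz, ← hzz, inv_inv, ← (hzcom _).eq]
          exact hc2
        have h5 := hO _ (Subgroup.mul_mem _ ⟨_, hi⟩ (Subgroup.inv_mem _ hcA)) h4
        have h6 : Commute (a * c⁻¹) g' := (Subgroup.mem_center_iff.1 h5 g').symm
        have h7 : Commute a g' := by
          have := h6.mul_left hcg
          simpa using this
        have h8 : z = 1 := by
          rw [← h7.eq] at h3
          exact (right_eq_mul.1 h3)
        exact absurd h8 hz1
  have hfin := hs g' hg'p (fun x => by
    rw [← commutatorElement_inv]; exact Subgroup.inv_mem _ (hcen x))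
  exact hg'A (hself g' (Subgroup.mem_center_iff.1 hfin a0).symm)

theorem lteN (p : ℕ) (hp : p.Prime) (h2 : p ≠ 2) (s : ℕ) (hs : s ≠ 0) (k : ℤ) (h : (p:ℤ)^s ∣ k^p - 1) :
    (p:ℤ)^s ∣ p * (k - 1) := by
  have : Fact p.Prime := ⟨hp⟩
  have h1 : (p:ℤ) ∣ k - 1 := by
    have h0 : (p:ℤ) ∣ k^p - 1 := (dvd_pow_self _ hs).trans h
    rw [← ZMod.intCast_zmod_eq_zero_iff_dvd] at h0 ⊢
    push_cast at h0 ⊢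
    rwa [ZMod.pow_card] at h0
  have hpk : ¬ (p:ℤ) ∣ k := by
    intro hk
    have := dvd_sub hk h1
    simp at this
    exact hp.one_lt.ne' (by simpa using Int.isUnit_iff_natAbs_eq.1 (isUnit_of_dvd_one this))
  have h3 := Int.emultiplicity_pow_sub_pow hp (hp.odd_of_ne_two h2) (x := k) (y := 1) h1 hpk p
  rw [one_pow] at h3
  rw [pow_dvd_iff_le_emultiplicity] at h ⊢
  rw [h3] at h
  rw [emultiplicity_mul (Nat.prime_iff_prime_int.1 hp), add_comm]
  rwa [Int.natCast_emultiplicity]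
theorem lteN2 (s : ℕ)  (k : ℤ) (h4 : 4 ∣ k - 1) (h : (2:ℤ)^s ∣ k^2 - 1) :
    (2:ℤ)^s ∣ 2 * (k - 1) := by
  obtain ⟨m, hm⟩ := h4
  have : k^2 - 1 = (2 * (k-1)) * (2 * m + 1) := by
    have : k = 4 * m + 1 := by omega
    subst this; ring
  rw [this] at h
  refine IsCoprime.dvd_of_dvd_mul_right ?_ h
  apply IsCoprime.pow_left
  exact ⟨-m, 1, by ring⟩

theorem exists_pow_notMem {P : Type*} [Group P] {p : ℕ} (hP : IsPGroup p P) (A : Subgroup P)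
    (g : P) (hg : g ∉ A) : ∃ n : ℕ, g ^ n ∉ A ∧ (g ^ n) ^ p ∈ A := by
  classical
  have hex : ∃ k, g ^ p ^ k ∈ A := by
    obtain ⟨k, hk⟩ := hP g
    exact ⟨k, by rw [hk]; exact A.one_mem⟩
  have hmin := fun m => Nat.find_min (m := m) hex
  have hs := Nat.find_spec hex
  generalize Nat.find hex = n at hmin hs
  cases n with
  | zero => simp at hs; exact absurd hs hg
  | succ n =>
    refine ⟨p ^ n, hmin n (Nat.lt_succ_self n), ?_⟩
    rw [← pow_mul, ← pow_succ]; exact hs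

theorem lemmaN_aux {P : Type*} [Group P] [Finite P] (p : ℕ) [Fact p.Prime] (hP : IsPGroup p P)
    (hnab : ∃ x y : P, x * y ≠ y * x) (a0 : P)
    (hself : ∀ g, g * a0 = a0 * g → g ∈ Subgroup.zpowers a0)
    (hnorm : (Subgroup.zpowers a0).Normal)
    (hO : ∀ a ∈ Subgroup.zpowers a0, a ^ p = 1 → a ∈ Subgroup.center P)
    (hs : ∀ a : P, a ^ p = 1 → (∀ x, ⁅a, x⁆ ∈ Subgroup.center P) → a ∈ Subgroup.center P) :
    p = 2 ∧ (Subgroup.zpowers a0).index = 2 := by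
  have hp : p.Prime := Fact.out
  have hk : ∀ g : P, ∃ k : ℤ, g * a0 * g⁻¹ = a0 ^ k := by
    intro g
    obtain ⟨k, hk⟩ := hnorm.conj_mem a0 (Subgroup.mem_zpowers a0) g
    exact ⟨k, hk.symm⟩
  have hki : ∀ (g : P) (k : ℤ), g * a0 * g⁻¹ = a0 ^ k → ∀ i : ℤ, g * a0 ^ i * g⁻¹ = a0 ^ (k * i) := by
    intro g k h i
    rw [← conj_zpow, h, zpow_mul]
  have hcomm : ∀ g h : P, ⁅g, h⁆ ∈ Subgroup.zpowers a0 := by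
    intro g h
    apply hself
    obtain ⟨k, hk1⟩ := hk g
    obtain ⟨l, hl1⟩ := hk h
    have e1 : (g * h) * a0 * (g * h)⁻¹ = (h * g) * a0 * (h * g)⁻¹ := by
      calc (g * h) * a0 * (g * h)⁻¹ = g * (h * a0 * h⁻¹) * g⁻¹ := by group
        _ = a0 ^ (k * l) := by rw [hl1, hki g k hk1]
        _ = h * (g * a0 * g⁻¹) * h⁻¹ := by rw [hk1, hki h l hl1, mul_comm]
        _ = _ := by group
    have e2 : ⁅g, h⁆ * a0 * ⁅g, h⁆⁻¹ = a0 := by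
      have e3 : (h * g) * ((h * g)⁻¹ * (g * h) * a0 * ((h * g)⁻¹ * (g * h))⁻¹) * (h * g)⁻¹
        = (h * g) * a0 * (h * g)⁻¹ := by
        rw [← e1]; group
      have e4 : (h * g)⁻¹ * (g * h) * a0 * ((h * g)⁻¹ * (g * h))⁻¹ = a0 := by
        have := mul_right_cancel e3
        exact mul_left_cancel this
      have e5 : (g * h) * ((h*g)⁻¹ * a0 * (h * g)) * (g * h)⁻¹ = a0 := by
        obtain ⟨k', hk1'⟩ := hk g⁻¹
        obtain ⟨l', hl1'⟩ := hk h⁻¹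
        have f1 : (h*g)⁻¹ * a0 * (h * g) = (g * h)⁻¹ * a0 * (g * h) := by
          calc (h*g)⁻¹ * a0 * (h * g) = g⁻¹ * (h⁻¹ * a0 * h⁻¹⁻¹) * g⁻¹⁻¹ := by group
            _ = a0 ^ (k' * l') := by rw [hl1', hki _ k' hk1']
            _ = h⁻¹ * (g⁻¹ * a0 * g⁻¹⁻¹) * h⁻¹⁻¹ := by rw [hk1', hki _ l' hl1', mul_comm]
            _ = _ := by group
        rw [f1]; group
      rw [commutatorElement_def]
      calc _ = (g * h) * ((h*g)⁻¹ * a0 * (h * g)) * (g * h)⁻¹ := by group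
        _ = a0 := e5
    exact mul_inv_eq_iff_eq_mul.1 e2
  obtain ⟨s, hos⟩ : ∃ s, orderOf a0 = p ^ s := by
    obtain ⟨n, hn⟩ := hP a0
    obtain ⟨s, _, hs⟩ := (Nat.dvd_prime_pow hp).1 (orderOf_dvd_of_pow_eq_one hn)
    exact ⟨s, hs⟩
  have hz1 : ∀ i : ℤ, a0 ^ i = 1 ↔ (p : ℤ) ^ s ∣ i := by
    intro i
    rw [← orderOf_dvd_iff_zpow_eq_one, hos]; push_cast; rfl
  have hnotall : ∃ x : P, x ∉ Subgroup.zpowers a0 := by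
    by_contra! hall
    obtain ⟨x, y, hxy⟩ := hnab
    obtain ⟨i, rfl⟩ := hall x
    obtain ⟨j, rfl⟩ := hall y
    exact hxy (Commute.zpow_zpow_self a0 _ _).eq
  have hnoc : ¬ a0 ^ p = 1 := by
    intro h
    obtain ⟨x, hx⟩ := hnotall
    exact hx (hself x (Subgroup.mem_center_iff.1 (hO a0 (Subgroup.mem_zpowers a0) h) x))
  have hs2 : 2 ≤ s := by
    by_contra! hlt
    apply hnoc
    have := (hz1 p).2 (by
      have : s = 0 ∨ s = 1 := by omega
      rcases this with rfl | rfl <;> simp)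
    simpa using this
  have hkpow : ∀ (g : P) (k : ℤ), g * a0 * g⁻¹ = a0 ^ k → ∀ n : ℕ,
      g ^ n * a0 * (g ^ n)⁻¹ = a0 ^ (k ^ n) := by
    intro g k h n
    induction n with
    | zero => simp
    | succ n ih =>
      calc g ^ (n + 1) * a0 * (g ^ (n+1))⁻¹ = g * (g ^ n * a0 * (g^n)⁻¹) * g⁻¹ := by
            rw [pow_succ']; group
        _ = _ := by rw [ih, hki g k h, pow_succ']
  have hkp : ∀ (g : P) (k : ℤ), g * a0 * g⁻¹ = a0 ^ k → g ^ p ∈ Subgroup.zpowers a0 →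
      (p : ℤ) ^ s ∣ k ^ p - 1 := by
    intro g k h hg
    rw [← hz1, zpow_sub, ← hkpow g k h]
    obtain ⟨j, hj⟩ := hg
    simp only at hj
    rw [← hj, (Commute.zpow_self a0 j).eq]; group
  have hzeta : ∀ (g : P) (k : ℤ), g * a0 * g⁻¹ = a0 ^ k → ⁅g, a0⁆ = a0 ^ (k - 1) := by
    intro g k h
    rw [commutatorElement_def, h, zpow_sub, zpow_one]
  by_cases hp2 : p = 2
  swap
  · exfalso
    obtain ⟨x, hx⟩ := hnotall
    obtain ⟨n, hn1, hn2⟩ := exists_pow_notMem hP _ x hx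
    obtain ⟨k, hk1⟩ := hk (x ^ n)
    have h1 := lteN p hp hp2 s (by omega) k (hkp _ _ hk1 hn2)
    refine claimE p a0 hself hcomm hO hs (x ^ n) hn1 ?_ (Or.inl hp2)
    rw [hzeta _ _ hk1, ← zpow_natCast, ← zpow_mul, hz1, mul_comm]
    exact h1
  refine ⟨hp2, ?_⟩
  subst hp2
  obtain ⟨t, rfl⟩ : ∃ t, s = t + 2 := ⟨s - 2, by omega⟩
  obtain ⟨c0, hc0⟩ : ∃ c0, c0 = a0 ^ ((2:ℤ) ^ t) := ⟨_, rfl⟩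
  have hc0z : ∀ i : ℤ, c0 ^ i = 1 ↔ 4 ∣ i := by
    intro i
    rw [hc0, ← zpow_mul, hz1, pow_add]
    push_cast
    rw [mul_dvd_mul_iff_left (by positivity)]
  have hgc : ∀ (g : P) (k : ℤ), g * a0 * g⁻¹ = a0 ^ k → g * c0 * g⁻¹ = c0 ^ k := by
    intro g k h
    rw [hc0, hki g k h, ← zpow_mul, mul_comm]
  have hno : ∀ g, Commute g c0 → g ∈ Subgroup.zpowers a0 := by
    intro g hg
    by_contra hgA
    obtain ⟨n, hn1, hn2⟩ := exists_pow_notMem hP _ g hgA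
    have hgn : Commute (g ^ n) c0 := hg.pow_left n
    obtain ⟨k, hk1⟩ := hk (g ^ n)
    have h4 : (4 : ℤ) ∣ k - 1 := by
      rw [← hc0z, zpow_sub, ← hgc _ _ hk1, hgn.eq]; simp
    have h1 := lteN2 (t + 2) k h4 (hkp _ _ hk1 hn2)
    refine claimE 2 a0 hself hcomm hO hs (g ^ n) hn1 ?_ (Or.inr ⟨rfl, ?_⟩)
    · rw [hzeta _ _ hk1, ← zpow_natCast, ← zpow_mul, hz1, mul_comm]
      exact_mod_cast h1
    · have h5 : (2:ℤ) * 2 ^ t ∣ k - 1 := by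
        rw [show (2:ℤ) ^ (t + 2) = 2 * (2 * 2 ^ t) by ring] at h1
        exact (mul_dvd_mul_iff_left (by norm_num)).1 h1
      obtain ⟨m, hm⟩ := h5
      refine ⟨c0 ^ m, ?_, (hgn.zpow_right m).symm, ?_⟩
      · rw [hc0]; exact Subgroup.zpow_mem _ (Subgroup.zpow_mem _ (Subgroup.mem_zpowers a0) _) _
      · rw [hzeta _ _ hk1, hm, hc0, ← zpow_mul, ← zpow_natCast, ← zpow_mul]
        congr 1; push_cast; ring
  have hinv : ∀ g, g ∉ Subgroup.zpowers a0 → g * c0 * g⁻¹ = c0⁻¹ := by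
    intro g hg
    obtain ⟨k, hk1⟩ := hk g
    have h1 := hgc g k hk1
    have hodd : ¬ (2:ℤ) ∣ k := by
      rintro ⟨m, rfl⟩
      have h2 : (g * c0 * g⁻¹) ^ (2:ℤ) = 1 := by
        rw [h1, ← zpow_mul, hc0z]; exact ⟨m, by ring⟩
      rw [conj_zpow, conj_eq_one_iff, hc0z] at h2
      norm_num at h2
    have h3 : ¬ (4 : ℤ) ∣ k - 1 := by
      intro h4
      rw [← hc0z, zpow_sub, ← h1, zpow_one, mul_inv_eq_one, mul_inv_eq_iff_eq_mul] at h4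
      exact hg (hno g h4)
    rw [h1, ← mul_eq_one_iff_eq_inv, ← zpow_add_one, hc0z]
    omega
  obtain ⟨a, ha⟩ := hnotall
  rw [Subgroup.index_eq_two_iff]
  refine ⟨a, fun b => ?_⟩
  by_cases hb : b ∈ Subgroup.zpowers a0
  · refine Or.inr ⟨hb, fun h => ha ((Subgroup.mul_mem_cancel_left _ hb).1 h)⟩
  · refine Or.inl ⟨hno _ ?_, hb⟩
    have : b * a * c0 * (b * a)⁻¹ = c0 := by
      calc _ = b * (a * c0 * a⁻¹) * b⁻¹ := by group
        _ = (b * c0 * b⁻¹)⁻¹ := by rw [hinv a ha]; group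
        _ = c0 := by rw [hinv b hb, inv_inv]
    exact mul_inv_eq_iff_eq_mul.1 this


theorem cyclic_of_pow {A : Type*} [CommGroup A] [Finite A] (p : ℕ) [Fact p.Prime] (hA : IsPGroup p A)
    (h : Nat.card (powMonoidHom p : A →* A).ker ≤ p) : IsCyclic A := by
  obtain ⟨n, hn⟩ := isPGroup_iff_exponent_eq_pow.1 hA
  apply IsCyclic.of_exponent_eq_card
  apply le_antisymm
  · exact Nat.le_of_dvd Nat.card_pos Group.exponent_dvd_nat_card
  · rw [hn]
    refine le_trans (le_of_eq ?_) (card_pow_le p h n)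
    have : (powMonoidHom (p ^ n) : A →* A).ker = ⊤ := by
      rw [eq_top_iff]
      intro x _
      rw [MonoidHom.mem_ker, powMonoidHom_apply, ← hn]
      exact Monoid.pow_exponent_eq_one x
    rw [this]; simp

theorem lemmaN {P : Type*} [Group P] [Finite P] (p : ℕ) [Fact p.Prime] (hP : IsPGroup p P)
    (hnab : ∃ x y : P, x * y ≠ y * x) (hZ : IsCyclic (Subgroup.center P))
    (hs : ∀ a : P, a ^ p = 1 → (∀ x, ⁅a, x⁆ ∈ Subgroup.center P) → a ∈ Subgroup.center P) :
    p = 2 ∧ ∃ A : Subgroup P, A.index = 2 ∧ ∀ a ∈ A, ∀ b ∈ A, a * b = b * a := by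
  classical
  have hnil : Group.IsNilpotent P := hP.isNilpotent
  obtain ⟨A, hAmax⟩ := Set.Finite.exists_maximal
    (s := {A : Subgroup P | A.Normal ∧ ∀ a ∈ A, ∀ b ∈ A, a * b = b * a}) (Set.toFinite _)
    ⟨⊥, inferInstance, by simp⟩
  obtain ⟨hAn, hAc⟩ := hAmax.prop
  have hcen : Subgroup.centralizer (A : Set P) ≤ A := by
    by_contra hle
    obtain ⟨g, hgC, hgA, hgx⟩ := exists_mem_comm_mem A (Subgroup.centralizer (A : Set P)) hle
    have hgc := Subgroup.mem_centralizer_iff.1 hgC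
    let B := A ⊔ Subgroup.zpowers g
    have hcomm : ∀ a ∈ B, ∀ b ∈ B, a * b = b * a := by
      intro x hx y hy
      obtain ⟨a, ha, _, ⟨i, rfl⟩, rfl⟩ := Subgroup.mem_sup_of_normal_left.1 hx
      obtain ⟨b, hb, _, ⟨j, rfl⟩, rfl⟩ := Subgroup.mem_sup_of_normal_left.1 hy
      have h1 : Commute a b := hAc a ha b hb
      have h2 : Commute a g := hgc a ha
      have h3 : Commute b g := hgc b hb
      exact ((h1.mul_right (h2.zpow_right j)).mul_left
        (((h3.symm.zpow_left i)).mul_right (Commute.zpow_zpow_self g i j))).eq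
    have hBn : B.Normal := by
      constructor
      intro n hn x
      obtain ⟨a, ha, _, ⟨i, rfl⟩, rfl⟩ := Subgroup.mem_sup_of_normal_left.1 hn
      have h1 : x * g * x⁻¹ ∈ B := by
        have : x * g * x⁻¹ = (⁅g, x⁆)⁻¹ * g := by rw [commutatorElement_def]; group
        rw [this]
        exact B.mul_mem (B.inv_mem (Subgroup.mem_sup_left (hgx x)))
          (Subgroup.mem_sup_right (Subgroup.mem_zpowers g))
      have : x * (a * g ^ i) * x⁻¹ = (x * a * x⁻¹) * (x * g * x⁻¹) ^ i := by
        rw [conj_zpow]; group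
      simp only
      rw [this]
      exact B.mul_mem (Subgroup.mem_sup_left (hAn.conj_mem a ha x)) (B.zpow_mem h1 i)
    have := hAmax.le_of_ge (y := B) ⟨hBn, hcomm⟩ le_sup_left
    exact hgA (this (Subgroup.mem_sup_right (Subgroup.mem_zpowers g)))
  let O : Subgroup P :=
    { carrier := {a | a ∈ A ∧ a ^ p = 1}
      one_mem' := ⟨A.one_mem, one_pow p⟩
      mul_mem' := by
        rintro a b ⟨ha, hap⟩ ⟨hb, hbp⟩
        refine ⟨A.mul_mem ha hb, ?_⟩
        rw [(show Commute a b from hAc a ha b hb).mul_pow, hap, hbp, one_mul]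
      inv_mem' := by
        rintro a ⟨ha, hap⟩
        exact ⟨A.inv_mem ha, by rw [inv_pow, hap, inv_one]⟩ }
  have hOn : O.Normal := by
    constructor
    rintro a ⟨ha, hap⟩ x
    exact ⟨hAn.conj_mem a ha x, by rw [conj_pow, hap]; group⟩
  have hOc : O ≤ Subgroup.center P := by
    by_contra hle
    obtain ⟨g, hgO, hgc, hgx⟩ := exists_mem_comm_mem (Subgroup.center P) O hle
    exact hgc (hs g hgO.2 hgx)
  let _ : CommGroup A := { (inferInstance : Group A) with
    mul_comm := fun a b => Subtype.ext (hAc a a.2 b b.2) }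
  have hcyc : IsCyclic A := by
    refine cyclic_of_pow p (hP.to_subgroup A) ?_
    have := Fintype.ofFinite (Subgroup.center P)
    refine le_trans ?_ (IsCyclic.card_pow_eq_one_le (α := Subgroup.center P) (n := p)
      (Fact.out : p.Prime).pos)
    have hmem : ∀ x : (powMonoidHom p : A →* A).ker, ((x : A) : P) ^ p = 1 := by
      intro x
      have := x.2
      rw [MonoidHom.mem_ker, powMonoidHom_apply] at this
      exact congrArg Subtype.val this
    rw [← Nat.card_eq_finsetCard]
    refine Nat.card_le_card_of_injective
      (fun x => ⟨⟨((x : A) : P), hOc ⟨x.1.2, hmem x⟩⟩, ?_⟩) ?_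
    · rw [Finset.mem_filter]
      exact ⟨Finset.mem_univ _, Subtype.ext (hmem x)⟩
    · intro x y hxy
      simp only [Subtype.mk.injEq] at hxy
      exact Subtype.ext (Subtype.ext hxy)
  obtain ⟨a0, ha0⟩ := (Subgroup.isCyclic_iff_exists_zpowers_eq_top A).1 hcyc
  subst ha0
  obtain ⟨h2, hi⟩ := lemmaN_aux p hP hnab a0 (fun g hg => hcen (by
    rw [Subgroup.mem_centralizer_iff]
    rintro _ ⟨i, rfl⟩
    exact ((show Commute g a0 from hg).zpow_right i).symm.eq)) hAn (fun a ha hap => hOc ⟨ha, hap⟩) hs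
  exact ⟨h2, _, hi, hAc⟩


section reps
variable {X : Type*} [Group X] {V : Type*} [AddCommGroup V]

theorem rep_one_iff (ρ : Representation ℤ X V) (x : X) : ρ x = 1 ↔ ∀ v, ρ x v = v := by
  rw [LinearMap.ext_iff]; rfl

theorem rep_mul (ρ : Representation ℤ X V) (x y : X) (v : V) : ρ (x * y) v = ρ x (ρ y v) := by
  rw [map_mul]; rfl

theorem rep_inv_apply (ρ : Representation ℤ X V) (x : X) (v : V) : ρ x⁻¹ (ρ x v) = v := by
  rw [← rep_mul]; simp

theorem rep_apply_inv (ρ : Representation ℤ X V) (x : X) (v : V) : ρ x (ρ x⁻¹ v) = v := by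
  rw [← rep_mul]; simp

theorem rep_inj (ρ : Representation ℤ X V) (x : X) {v w : V} (h : ρ x v = ρ x w) : v = w := by
  rw [← rep_inv_apply ρ x v, h, rep_inv_apply]

/-- restriction to an invariant submodule -/
def subRep (ρ : Representation ℤ X V) (W : Submodule ℤ V) (hW : ∀ x, ∀ v ∈ W, ρ x v ∈ W) :
    Representation ℤ X W where
  toFun x := (ρ x).restrict (hW x)
  map_one' := by ext; simp
  map_mul' x y := by ext; simp

/-- action on the quotient by an invariant submodule -/
def quotRep (ρ : Representation ℤ X V) (W : Submodule ℤ V) (hW : ∀ x, ∀ v ∈ W, ρ x v ∈ W) :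
    Representation ℤ X (V ⧸ W) where
  toFun x := W.mapQ W (ρ x) (hW x)
  map_one' := by ext; simp
  map_mul' x y := by ext; simp

theorem subRep_one_iff (ρ : Representation ℤ X V) (W : Submodule ℤ V)
    (hW : ∀ x, ∀ v ∈ W, ρ x v ∈ W) (x : X) : subRep ρ W hW x = 1 ↔ ∀ v ∈ W, ρ x v = v := by
  rw [rep_one_iff]
  constructor
  · intro h v hv
    exact congrArg Subtype.val (h ⟨v, hv⟩)
  · rintro h ⟨v, hv⟩
    exact Subtype.ext (h v hv)

theorem quotRep_one_iff (ρ : Representation ℤ X V) (W : Submodule ℤ V)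
    (hW : ∀ x, ∀ v ∈ W, ρ x v ∈ W) (x : X) : quotRep ρ W hW x = 1 ↔ ∀ v, ρ x v - v ∈ W := by
  rw [rep_one_iff]
  constructor
  · intro h v
    exact (Submodule.Quotient.eq W).1 (h (Submodule.Quotient.mk v))
  · intro h v
    obtain ⟨v, rfl⟩ := Submodule.Quotient.mk_surjective W v
    exact (Submodule.Quotient.eq W).2 (h v)

/-- elements act with order coprime to `|V|` -/
def CoAct (ρ : Representation ℤ X V) : Prop :=
  ∀ x, ∃ m : ℕ, m.Coprime (Nat.card V) ∧ ρ (x ^ m) = 1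

theorem CoAct.sub {ρ : Representation ℤ X V} (h : CoAct ρ) (W : Submodule ℤ V)
    (hW : ∀ x, ∀ v ∈ W, ρ x v ∈ W) : CoAct (subRep ρ W hW) := by
  intro x
  obtain ⟨m, hm, hx⟩ := h x
  refine ⟨m, hm.coprime_dvd_right ⟨_, Submodule.card_eq_card_quotient_mul_card W⟩, ?_⟩
  rw [subRep_one_iff]
  intro v _
  exact (rep_one_iff ρ _).1 hx v

theorem CoAct.quot {ρ : Representation ℤ X V} (h : CoAct ρ) (W : Submodule ℤ V)
    (hW : ∀ x, ∀ v ∈ W, ρ x v ∈ W) : CoAct (quotRep ρ W hW) := by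
  intro x
  obtain ⟨m, hm, hx⟩ := h x
  refine ⟨m, hm.coprime_dvd_right ⟨_, (Submodule.card_eq_card_quotient_mul_card W).trans
    (mul_comm _ _)⟩, ?_⟩
  rw [quotRep_one_iff]
  intro v
  rw [(rep_one_iff ρ _).1 hx v, sub_self]
  exact W.zero_mem

theorem CoAct.restr {ρ : Representation ℤ X V} (h : CoAct ρ) (M : Subgroup X) :
    CoAct (ρ.comp M.subtype : Representation ℤ M V) := by
  intro x
  obtain ⟨m, hm, hx⟩ := h x
  exact ⟨m, hm, hx⟩

theorem eq_zero_of_coprime_smul [Finite V] {m : ℕ} (hm : m.Coprime (Nat.card V)) {v : V}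
    (h : m • v = 0) : v = 0 := by
  have h1 : addOrderOf v ∣ m := addOrderOf_dvd_of_nsmul_eq_zero h
  have h2 : addOrderOf v ∣ Nat.card V := addOrderOf_dvd_natCard v
  have := Nat.dvd_gcd h1 h2
  rw [hm] at this
  simpa using this

theorem CoAct.eq_one [Finite V] {ρ : Representation ℤ X V} (h : CoAct ρ) (W : Submodule ℤ V)
    (x : X) (h1 : ∀ v ∈ W, ρ x v = v) (h2 : ∀ v, ρ x v - v ∈ W) : ρ x = 1 := by
  rw [rep_one_iff]
  intro v
  obtain ⟨m, hm, hx⟩ := h x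
  have key : ∀ k : ℕ, ρ (x ^ k) v = v + k • (ρ x v - v) := by
    intro k
    induction k with
    | zero => simp
    | succ k ih =>
      rw [pow_succ', rep_mul, ih, map_add, map_nsmul, h1 _ (h2 v), succ_nsmul]
      abel
  have h3 := key m
  rw [(rep_one_iff ρ _).1 hx v] at h3
  have h4 := eq_zero_of_coprime_smul hm (left_eq_add.1 h3)
  exact sub_eq_zero.1 h4

end reps


/-- The statement of the main counting theorem for modules of size `n`. -/
def StC (n : ℕ) : Prop :=
  ∀ (X : Type u) [Group X] [Finite X] [Group.IsNilpotent X] (V : Type v) [AddCommGroup V]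
    [Finite V] (ρ : Representation ℤ X V), Nat.card V = n → 1 < n → CoAct ρ →
    ∀ L R : Subgroup X, CenPair L R → (∀ r ∈ R, ρ r = 1 → r ∈ L) →
      L.relIndex R < n ∧ ∀ p : ℕ, p.Prime →
        (∃ x y : X, (∃ k : ℕ, x ^ p ^ k = 1) ∧ (∃ k : ℕ, y ^ p ^ k = 1) ∧ ρ ⁅x, y⁆ ≠ 1) →
        p * L.relIndex R < n

/-- Splitting along an invariant submodule. -/
theorem split_pair {X : Type*} [Group X] {V : Type*} [AddCommGroup V] [Finite V]
    (ρ : Representation ℤ X V) (hco : CoAct ρ) (W : Submodule ℤ V)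
    (hW : ∀ x, ∀ v ∈ W, ρ x v ∈ W) (L R : Subgroup X) (hLR : CenPair L R)
    (hf : ∀ r ∈ R, ρ r = 1 → r ∈ L) :
    ∃ L1 R1 L2 R2 : Subgroup X, CenPair L1 R1 ∧ CenPair L2 R2 ∧
      (∀ r ∈ R1, subRep ρ W hW r = 1 → r ∈ L1) ∧ (∀ r ∈ R2, quotRep ρ W hW r = 1 → r ∈ L2) ∧
      L.relIndex R = L1.relIndex R1 * L2.relIndex R2 := by
  have hLn : L.Normal := hLR.conj le_rfl hLR.1
  let K := (subRep ρ W hW).ker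
  refine ⟨L ⊔ (R ⊓ K), R, L ⊓ K, R ⊓ K, ⟨sup_le hLR.1 inf_le_left, fun r hr x =>
    Subgroup.mem_sup_left (hLR.2 r hr x)⟩, ⟨inf_le_inf_right _ hLR.1, ?_⟩, ?_, ?_,
    relIndex_split L R K hLR.1⟩
  · rintro r ⟨hr, hrK⟩ x
    refine ⟨hLR.2 r hr x, ?_⟩
    have : ⁅r, x⁆ = r * (x * r⁻¹ * x⁻¹) := by simp [commutatorElement_def, mul_assoc]
    rw [this]
    exact K.mul_mem hrK (Subgroup.Normal.conj_mem inferInstance _ (K.inv_mem hrK) x)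
  · intro r hr h1
    exact Subgroup.mem_sup_right ⟨hr, h1⟩
  · rintro r ⟨hr, hrK⟩ h1
    refine ⟨hf r hr ?_, hrK⟩
    exact hco.eq_one W r ((subRep_one_iff ρ W hW r).1 hrK) ((quotRep_one_iff ρ W hW r).1 h1)

instance finite_quot_sub {V : Type*} [AddCommGroup V] [Finite V] (W : Submodule ℤ V) :
    Finite (V ⧸ W) := Finite.of_surjective _ (Submodule.Quotient.mk_surjective W)

theorem card_sub_lt {V : Type*} [AddCommGroup V] [Finite V] (W : Submodule ℤ V) (h : W ≠ ⊤) :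
    Nat.card W < Nat.card V := by
  refine lt_of_le_of_ne (Nat.card_le_card_of_injective _ W.subtype_injective) fun he => h ?_
  have h2 : W.toAddSubgroup = ⊤ := AddSubgroup.eq_top_of_card_eq _ he
  rw [eq_top_iff]
  intro x _
  have : x ∈ W.toAddSubgroup := h2 ▸ AddSubgroup.mem_top x
  exact this

theorem one_lt_card_sub {V : Type*} [AddCommGroup V] [Finite V] (W : Submodule ℤ V) (h : W ≠ ⊥) :
    1 < Nat.card W := by
  rw [Finite.one_lt_card_iff_nontrivial]
  exact Submodule.nontrivial_iff_ne_bot.2 h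

theorem one_lt_card_quot {V : Type*} [AddCommGroup V] [Finite V] (W : Submodule ℤ V) (h : W ≠ ⊤) :
    1 < Nat.card (V ⧸ W) := by
  have h1 := card_sub_lt W h
  rw [Submodule.card_eq_card_quotient_mul_card W] at h1
  by_contra! h2
  nlinarith [Nat.zero_le (Nat.card W)]

theorem card_quot_lt {V : Type*} [AddCommGroup V] [Finite V] (W : Submodule ℤ V) (h : W ≠ ⊥) :
    Nat.card (V ⧸ W) < Nat.card V := by
  have h1 := one_lt_card_sub W h
  rw [Submodule.card_eq_card_quotient_mul_card W]
  have : 0 < Nat.card (V ⧸ W) := Nat.card_pos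
  nlinarith

theorem stC_reducible (n : ℕ) (ih : ∀ m < n, StC.{u, v} m)
    (X : Type u) [Group X] [Finite X] [Group.IsNilpotent X] (V : Type v) [AddCommGroup V]
    [Finite V] (ρ : Representation ℤ X V) (hn : Nat.card V = n) (hco : CoAct ρ)
    (L R : Subgroup X) (hLR : CenPair L R) (hf : ∀ r ∈ R, ρ r = 1 → r ∈ L)
    (W : Submodule ℤ V) (hW : ∀ x, ∀ v ∈ W, ρ x v ∈ W) (hb : W ≠ ⊥) (ht : W ≠ ⊤) :
      L.relIndex R < n ∧ ∀ p : ℕ, p.Prime →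
        (∃ x y : X, (∃ k : ℕ, x ^ p ^ k = 1) ∧ (∃ k : ℕ, y ^ p ^ k = 1) ∧ ρ ⁅x, y⁆ ≠ 1) →
        p * L.relIndex R < n := by
  obtain ⟨L1, R1, L2, R2, hp1, hp2, hf1, hf2, he⟩ := split_pair ρ hco W hW L R hLR hf
  have hc := Submodule.card_eq_card_quotient_mul_card W
  obtain ⟨i1, j1⟩ := ih (Nat.card W) (hn ▸ card_sub_lt W ht) X W (subRep ρ W hW) rfl
    (one_lt_card_sub W hb) (hco.sub W hW) L1 R1 hp1 hf1
  obtain ⟨i2, j2⟩ := ih (Nat.card (V ⧸ W)) (hn ▸ card_quot_lt W hb) X (V ⧸ W) (quotRep ρ W hW) rfl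
    (one_lt_card_quot W ht) (hco.quot W hW) L2 R2 hp2 hf2
  rw [he, ← hn, hc]
  refine ⟨Nat.mul_lt_mul'' i1 i2, ?_⟩
  rintro p hp ⟨x, y, hx, hy, hxy⟩
  by_cases h1 : subRep ρ W hW ⁅x, y⁆ = 1
  · have h2 : quotRep ρ W hW ⁅x, y⁆ ≠ 1 := by
      intro h2
      exact hxy (hco.eq_one W _ ((subRep_one_iff ρ W hW _).1 h1) ((quotRep_one_iff ρ W hW _).1 h2))
    have := Nat.mul_lt_mul'' i1 (j2 p hp ⟨x, y, hx, hy, h2⟩)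
    calc _ = L1.relIndex R1 * (p * L2.relIndex R2) := by ring
      _ < _ := this
  · have := Nat.mul_lt_mul'' (j1 p hp ⟨x, y, hx, hy, h1⟩) i2
    calc _ = (p * L1.relIndex R1) * L2.relIndex R2 := by ring
      _ < _ := this


theorem schur_cyclic {Y : Type*} [Group Y] {V : Type*} [AddCommGroup V] [Finite V] [Nontrivial V]
    (σ : Representation ℤ Y V)
    (hirr : ∀ W : Submodule ℤ V, (∀ y, ∀ v ∈ W, σ y v ∈ W) → W = ⊥ ∨ W = ⊤)
    {A : Type*} [Group A] [Finite A] (α : A →* (V →ₗ[ℤ] V)) (hinj : Function.Injective α)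
    (hcomm : ∀ a y, ∀ v, α a (σ y v) = σ y (α a v)) : IsCyclic A := by
  let D : Subring (Module.End ℤ V) := Subring.centralizer (Set.range σ)
  have hfin : Finite (Module.End ℤ V) := DFunLike.finite (Module.End ℤ V)
  have hker : ∀ d : D, d ≠ 0 → ∀ v, (d : Module.End ℤ V) v = 0 → v = 0 := by
    intro d hd v hv
    have h1 : ∀ y, ∀ v ∈ LinearMap.ker (d : Module.End ℤ V), σ y v ∈ LinearMap.ker (d : Module.End ℤ V) := by
      intro y w hw
      rw [LinearMap.mem_ker] at hw ⊢
      have h2 := Subring.mem_centralizer_iff.1 d.2 (σ y) ⟨y, rfl⟩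
      have h3 := LinearMap.congr_fun h2 w
      rw [Module.End.mul_apply, Module.End.mul_apply, hw, map_zero] at h3
      exact h3.symm
    rcases hirr _ h1 with h | h
    · have : v ∈ LinearMap.ker (d : Module.End ℤ V) := hv
      rw [h] at this
      simpa using this
    · exact absurd (Subtype.ext (LinearMap.ker_eq_top.1 h)) hd
  have hnzd : NoZeroDivisors D := by
    constructor
    intro a b hab
    by_contra! hne
    apply hne.2
    apply Subtype.ext
    apply LinearMap.ext
    intro v
    exact hker a hne.1 _ (LinearMap.congr_fun (congrArg Subtype.val hab) v)
  have hnt : Nontrivial D := by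
    refine ⟨0, 1, fun h => ?_⟩
    obtain ⟨v, hv⟩ := exists_ne (0 : V)
    exact hv (LinearMap.congr_fun (congrArg Subtype.val h) v).symm
  have hdom : IsDomain D := NoZeroDivisors.to_isDomain D
  have hcm : ∀ a b : D, a * b = b * a := by
    classical
    have := Fintype.ofFinite D
    let _ : DivisionRing D := Fintype.divisionRingOfIsDomain D
    intro a b
    exact (littleWedderburn D).mul_comm a b
  let _ : CommRing D := { (inferInstance : Ring D) with mul_comm := hcm }
  have hdom : IsDomain D := NoZeroDivisors.to_isDomain D
  let f : A →* D :=
    { toFun := fun a => ⟨α a, by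
        rw [Subring.mem_centralizer_iff]
        rintro _ ⟨y, rfl⟩
        apply LinearMap.ext
        intro v
        exact (hcomm a y v).symm⟩
      map_one' := Subtype.ext (map_one α)
      map_mul' := fun a b => Subtype.ext (map_mul α a b) }
  exact isCyclic_of_injective_ringHom f fun a b hab => hinj (congrArg Subtype.val hab)

section irr
variable {X : Type*} [Group X] {V : Type*} [AddCommGroup V]

/-- no proper nonzero invariant submodules -/
def Irr (ρ : Representation ℤ X V) : Prop :=
  ∀ W : Submodule ℤ V, (∀ x, ∀ v ∈ W, ρ x v ∈ W) → W = ⊥ ∨ W = ⊤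

/-- the fixed points of a normal subgroup: trivial or everything -/
theorem Irr.fix {ρ : Representation ℤ X V} (h : Irr ρ) (N : Subgroup X) (hN : N.Normal) {v : V}
    (hv : v ≠ 0) (hf : ∀ x ∈ N, ρ x v = v) : ∀ x ∈ N, ρ x = 1 := by
  let W : Submodule ℤ V :=
    { carrier := {w | ∀ x ∈ N, ρ x w = w}
      zero_mem' := by intro x _; simp
      add_mem' := by intro a b ha hb x hx; rw [map_add, ha x hx, hb x hx]
      smul_mem' := by intro c a ha x hx; rw [map_smul, ha x hx] }
  have hW : ∀ x, ∀ w ∈ W, ρ x w ∈ W := by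
    intro x w hw y hy
    have h1 : x⁻¹ * y * x ∈ N := by simpa using hN.conj_mem y hy x⁻¹
    have h2 := hw _ h1
    rw [← rep_mul]
    have : y * x = x * (x⁻¹ * y * x) := by group
    rw [this, rep_mul, h2]
  rcases h W hW with hb | ht
  · have : v ∈ W := hf
    rw [hb] at this
    exact absurd (by simpa using this) hv
  · intro x hx
    rw [rep_one_iff]
    intro w
    have : w ∈ W := by rw [ht]; trivial
    exact this x hx

theorem Irr.fix_central {ρ : Representation ℤ X V} (h : Irr ρ) (hfaith : ∀ x, ρ x = 1 → x = 1)
    {z : X} (hz : z ∈ Subgroup.center X) (hz1 : z ≠ 1) {v : V} (hv : ρ z v = v) : v = 0 := by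
  by_contra hne
  refine hz1 (hfaith z (h.fix (Subgroup.zpowers z) ?_ hne ?_ z (Subgroup.mem_zpowers z)))
  · constructor
    rintro _ ⟨i, rfl⟩ x
    have : x * z ^ i * x⁻¹ = z ^ i := by
      rw [((show Commute x z from Subgroup.mem_center_iff.1 hz x).zpow_right i).eq]; group
    simp only
    rw [this]
    exact ⟨i, rfl⟩
  · rintro _ ⟨i, rfl⟩
    have hnat : ∀ i : ℕ, ρ (z ^ i) v = v := by
      intro i
      induction i with
      | zero => simp
      | succ i ih => rw [pow_succ, rep_mul, hv, ih]
    cases i with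
    | ofNat i => simpa using hnat i
    | negSucc i =>
      simp only [zpow_negSucc]
      conv_lhs => rw [← hnat (i + 1)]
      rw [rep_inv_apply]

theorem stC_abelian [Finite X] [Finite V] [Nontrivial V] (ρ : Representation ℤ X V) (h : Irr ρ)
    (hfaith : ∀ x, ρ x = 1 → x = 1) (hab : ∀ x y : X, x * y = y * x) (L R : Subgroup X) :
    L.relIndex R < Nat.card V := by
  classical
  obtain ⟨v, hv⟩ := exists_ne (0 : V)
  have h1 : L.relIndex R ≤ Nat.card R := Nat.le_of_dvd Nat.card_pos (Subgroup.relIndex_dvd_card L R)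
  have h2 : Nat.card R < Nat.card V := by
    have hinj : Function.Injective (fun r : R => ρ r v) := by
      intro r s hrs
      simp only at hrs
      by_contra hne
      refine hv (h.fix_central hfaith (z := (s : X)⁻¹ * r) ?_ ?_ ?_)
      · rw [Subgroup.mem_center_iff]; intro g; exact hab _ _
      · intro h1
        rw [inv_mul_eq_one] at h1
        exact hne (Subtype.ext h1.symm)
      · rw [rep_mul, hrs, rep_inv_apply]
    have := Fintype.ofFinite R
    have := Fintype.ofFinite V
    rw [Nat.card_eq_fintype_card, Nat.card_eq_fintype_card]
    refine Fintype.card_lt_of_injective_of_notMem _ hinj (b := 0) ?_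
    rintro ⟨r, hr⟩
    simp only at hr
    apply hv
    rw [← rep_inv_apply ρ r v, hr, map_zero]
  omega

end irr

/-- in a nonabelian finite nilpotent group there are noncommuting p-elements -/
theorem exists_p_noncomm {X : Type*} [Group X] [Finite X] [Group.IsNilpotent X]
    (h : ¬ ∀ x y : X, x * y = y * x) :
    ∃ p : ℕ, p.Prime ∧ ∃ x y : X, (∃ k : ℕ, x ^ p ^ k = 1) ∧ (∃ k : ℕ, y ^ p ^ k = 1) ∧
      x * y ≠ y * x := by
  obtain ⟨e⟩ := ((Group.isNilpotent_of_finite_tfae (G := X)).out 0 4).1 ‹Group.IsNilpotent X›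
  by_contra! hall
  apply h
  intro x y
  apply e.symm.injective
  rw [map_mul, map_mul]
  funext p P
  have hp : (p : ℕ).Prime := (Nat.mem_primeFactors.1 p.2).1
  apply Subtype.ext
  have hP : ∀ a : P, ∃ k : ℕ, (a : X) ^ (p : ℕ) ^ k = 1 := by
    intro a
    obtain ⟨k, hk⟩ := P.isPGroup' a
    exact ⟨k, congrArg Subtype.val hk⟩
  exact hall p hp _ _ (hP _) (hP _)


/-- `r = a * h` with commuting coprime orders: `a` is a power of `r` -/
theorem part_mem {X : Type*} [Group X] (R : Subgroup X) {a h : X} (hah : Commute a h) {m n : ℕ}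
    (ha : a ^ m = 1) (hh : h ^ n = 1) (hmn : m.Coprime n) (hr : a * h ∈ R) : a ∈ R := by
  obtain ⟨k, hk1, hk2⟩ := Nat.chineseRemainder hmn 1 0
  have h1 : (a * h) ^ k = a := by
    rw [hah.mul_pow]
    have e1 : a ^ k = a := by
      conv_rhs => rw [← pow_one a]
      exact pow_eq_pow_iff_modEq.2 (hk1.of_dvd (orderOf_dvd_of_pow_eq_one ha))
    have e2 : h ^ k = 1 := by
      obtain ⟨t, rfl⟩ := (Nat.modEq_zero_iff_dvd).1 hk2
      rw [pow_mul, hh, one_pow]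
    rw [e1, e2, mul_one]
  rw [← h1]
  exact R.pow_mem hr k

theorem comm_mul_eq {X : Type*} [Group X] (a b x : X) :
    ⁅a * b, x⁆ = a * ⁅b, x⁆ * a⁻¹ * ⁅a, x⁆ := by
  simp only [commutatorElement_def]; group

theorem card_modEq_one {G : Type*} [Group G] {p : ℕ} [Fact p.Prime] (hG : IsPGroup p G)
    {U : Type*} [AddCommGroup U] [Finite U] (σ : Representation ℤ G U)
    (h : ∀ u, (∀ g, σ g u = u) → u = 0) : Nat.card U ≡ 1 [MOD p] := by
  let _ : MulAction G U :=
    { smul := fun g u => σ g u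
      one_smul := fun u => by show σ 1 u = u; simp
      mul_smul := fun g k u => rep_mul σ g k u }
  have h1 := hG.card_modEq_card_fixedPoints U
  have h2 : Nat.card (MulAction.fixedPoints G U) = 1 := by
    rw [Nat.card_eq_one_iff_unique]
    refine ⟨⟨fun a b => Subtype.ext ?_⟩, ⟨⟨0, fun g => map_zero (σ g)⟩⟩⟩
    rw [h a.1 a.2, h b.1 b.2]
  rwa [h2] at h1

theorem comm_index_le {X : Type*} [Group X] [Finite X] (B L : Subgroup X)
    (hB : ∀ a ∈ B, ∀ b ∈ B, a * b = b * a) (x : X) (hBn : ∀ r ∈ B, ⁅r, x⁆ ∈ B)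
    (hL : ∀ r ∈ B, ⁅r, x⁆ ∈ L) :
    L.relIndex B ≤ Nat.card (B ⊓ Subgroup.centralizer {x} : Subgroup X) := by
  let f : B →* B :=
    { toFun := fun r => ⟨⁅(r : X), x⁆, hBn r r.2⟩
      map_one' := Subtype.ext (by simp)
      map_mul' := by
        intro r s
        apply Subtype.ext
        have h1 : (s : X) * ⁅(r : X), x⁆ = ⁅(r : X), x⁆ * s := hB _ s.2 _ (hBn r r.2)
        have h2 : (r : X) * ⁅(s : X), x⁆ = ⁅(s : X), x⁆ * r := hB _ r.2 _ (hBn s s.2)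
        have h3 : ⁅(r : X), x⁆ * ⁅(s : X), x⁆ = ⁅(s : X), x⁆ * ⁅(r : X), x⁆ :=
          hB _ (hBn r r.2) _ (hBn s s.2)
        show ⁅(r : X) * s, x⁆ = ⁅(r : X), x⁆ * ⁅(s : X), x⁆
        rw [comm_mul_eq, h2, h3, mul_inv_cancel_right] }
  have h1 : f.range ≤ L.subgroupOf B := by
    rintro _ ⟨r, rfl⟩
    exact hL r r.2
  have h2 : L.relIndex B ≤ f.range.index :=
    Nat.le_of_dvd (Nat.pos_of_ne_zero Subgroup.FiniteIndex.index_ne_zero) (Subgroup.index_dvd_of_le h1)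
  have h3 := Subgroup.card_mul_index f.range
  have h4 := Subgroup.card_mul_index f.ker
  rw [Subgroup.index_ker, ← h3] at h4
  have h5 : f.range.index = Nat.card f.ker := by
    rw [mul_comm] at h4
    exact (Nat.eq_of_mul_eq_mul_left Nat.card_pos h4).symm
  rw [h5] at h2
  refine h2.trans ?_
  refine Nat.card_le_card_of_injective (fun r => ⟨((r : B) : X), r.1.2, ?_⟩) ?_
  · have hr : ⁅((r : B) : X), x⁆ = 1 := congrArg Subtype.val (MonoidHom.mem_ker.1 r.2)
    show ((r : B) : X) ∈ Subgroup.centralizer {x}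
    rw [Subgroup.mem_centralizer_iff]
    rintro _ rfl
    exact (commutatorElement_eq_one_iff_mul_comm.1 hr).symm
  · intro r s hrs
    apply Subtype.ext
    apply Subtype.ext
    have h6 := Subtype.ext_iff.1 hrs
    exact h6

theorem lemma_b {X : Type u} [Group X] [Finite X] [Group.IsNilpotent X] {V : Type v}
    [AddCommGroup V] [Finite V] (ρ : Representation ℤ X V) (hco : CoAct ρ) (hirr : Irr ρ)
    (hfaith : ∀ x, ρ x = 1 → x = 1) (L R : Subgroup X) (hLR : CenPair L R)
    (p : ℕ) (hp : p.Prime) (P H : Subgroup X) (hPp : ∀ a ∈ P, ∃ k : ℕ, a ^ p ^ k = 1)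
    (hHp : (Nat.card H).Coprime p)
    (hPH : ∀ a ∈ P, ∀ b ∈ H, a * b = b * a) (hsup : P ⊔ H = ⊤) (hdis : P ⊓ H = ⊥)
    (hHn : H.Normal) (A : Subgroup X) (hAP : A ≤ P) (hAn : A.Normal) (hAi : A.relIndex P = p)
    (hAc : ∀ a ∈ A, ∀ b ∈ A, a * b = b * a)
    (U : Submodule ℤ V) (hU : ∀ y ∈ Subgroup.center X ⊔ H, ∀ v ∈ U, ρ y v ∈ U) (hUb : U ≠ ⊥)
    (ih : StC.{u, v} (Nat.card U)) (z : X) (hz : z ∈ Subgroup.center X) (hzp : z ^ p = 1)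
    (hz1 : z ≠ 1) :
    L.relIndex R ≤ p * (Nat.card U - 1) ∧ p + 1 ≤ Nat.card U := by
  have hLn : L.Normal := hLR.conj le_rfl hLR.1
  constructor
  swap
  · -- counting
    have : Fact p.Prime := ⟨hp⟩
    have hzle : Subgroup.zpowers z ≤ Subgroup.center X := by simpa using hz
    have hzo : orderOf z = p := orderOf_eq_prime hzp hz1
    have hZp : IsPGroup p (Subgroup.zpowers z) := by
      refine IsPGroup.of_card (n := 1) ?_
      rw [Nat.card_zpowers, hzo, pow_one]
    have h1 := card_modEq_one hZp (subRep (ρ.comp (Subgroup.zpowers z).subtype :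
      Representation ℤ (Subgroup.zpowers z) V) U
      (fun y => hU y (Subgroup.mem_sup_left (hzle y.2)))) (by
        intro w hw
        apply Subtype.ext
        exact hirr.fix_central hfaith hz hz1
          (congrArg Subtype.val (hw ⟨z, Subgroup.mem_zpowers z⟩)))
    have h2 := one_lt_card_sub U hUb
    have h3 : p ∣ Nat.card U - 1 := (Nat.modEq_iff_dvd' h2.le).1 h1.symm
    have := Nat.le_of_dvd (by omega) h3
    omega
  -- x
  obtain ⟨x, hxP, hxA⟩ : ∃ x ∈ P, x ∉ A := by
    by_contra! hle
    have : A.relIndex P = 1 := Subgroup.relIndex_eq_one.2 hle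
    rw [hAi] at this
    exact hp.one_lt.ne' this
  have hAx : A ⊔ Subgroup.zpowers x = P := by
    have hle : A ⊔ Subgroup.zpowers x ≤ P := sup_le hAP (by simpa using hxP)
    have h1 := Subgroup.relIndex_mul_relIndex A (A ⊔ Subgroup.zpowers x) P le_sup_left hle
    rw [hAi] at h1
    have h2 : A.relIndex (A ⊔ Subgroup.zpowers x) ≠ 1 := by
      intro h
      exact hxA (Subgroup.relIndex_eq_one.1 h (Subgroup.mem_sup_right (Subgroup.mem_zpowers x)))
    have h3 : (A ⊔ Subgroup.zpowers x).relIndex P = 1 := by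
      rcases (Nat.dvd_prime hp).1 ⟨_, h1.symm⟩ with h | h
      · exact absurd h h2
      · rw [h] at h1
        exact Nat.eq_of_mul_eq_mul_left hp.pos (by rw [h1, mul_one])
    exact le_antisymm hle (Subgroup.relIndex_eq_one.1 h3)
  -- central elements
  have hcent : A ⊓ Subgroup.centralizer {x} ≤ Subgroup.center X := by
    rintro c ⟨hcA, hcx⟩
    have hcx : x * c = c * x := Subgroup.mem_centralizer_iff.1 hcx x rfl
    have h1 : P ⊔ H ≤ Subgroup.centralizer {c} := by
      rw [← hAx]
      refine sup_le (sup_le ?_ ?_) ?_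
      · intro a ha
        rw [Subgroup.mem_centralizer_iff]
        rintro _ rfl
        exact hAc _ hcA a ha
      · rw [Subgroup.zpowers_le, Subgroup.mem_centralizer_iff]
        rintro _ rfl
        exact hcx.symm
      · intro b hb
        rw [Subgroup.mem_centralizer_iff]
        rintro _ rfl
        exact hPH _ (hAP hcA) b hb
    rw [Subgroup.mem_center_iff]
    intro g
    have : g ∈ Subgroup.centralizer {c} := h1 (by rw [hsup]; trivial)
    exact (Subgroup.mem_centralizer_iff.1 this c rfl).symm
  -- first splitting
  let K := A ⊔ H
  have hKn : K.Normal := inferInstance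
  have hKi : K.index ≤ p := by
    have h1 : K.index = K.relIndex P := by
      rw [← Subgroup.relIndex_sup_right, ← Subgroup.relIndex_top_right]
      congr 1
      rw [eq_comm, eq_top_iff, ← hsup]
      exact sup_le le_sup_left (le_sup_right.trans le_sup_right)
    rw [h1, ← hAi]
    exact Subgroup.relIndex_le_of_le_left le_sup_left (by rw [hAi]; exact hp.ne_zero)
  have e1 := relIndex_split L R K hLR.1
  have e1' : (L ⊔ (R ⊓ K)).relIndex R ≤ p := by
    refine le_trans ?_ hKi
    calc (L ⊔ (R ⊓ K)).relIndex R ≤ (R ⊓ K).relIndex R :=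
          Subgroup.relIndex_le_of_le_left le_sup_right Subgroup.FiniteIndex.index_ne_zero
      _ = K.relIndex R := by rw [inf_comm, Subgroup.inf_relIndex_right]
      _ ≤ K.index := Nat.le_of_dvd (Nat.pos_of_ne_zero Subgroup.FiniteIndex.index_ne_zero)
          (Subgroup.relIndex_dvd_index_of_normal K R)
  -- second splitting
  have e2 := relIndex_split (L ⊓ K) (R ⊓ K) H (inf_le_inf_right _ hLR.1)
  have hHK : H ≤ K := le_sup_right
  have i1 : L ⊓ K ⊓ H = L ⊓ H := by rw [inf_assoc, inf_eq_right.2 hHK]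
  have i2 : R ⊓ K ⊓ H = R ⊓ H := by rw [inf_assoc, inf_eq_right.2 hHK]
  rw [i1, i2] at e2
  have hRHn : (R ⊓ H).Normal := by
    have : R.Normal := hLR.conj hLR.1 le_rfl
    infer_instance
  have hRAn : (R ⊓ A).Normal := by
    have : R.Normal := hLR.conj hLR.1 le_rfl
    infer_instance
  have hdec : R ⊓ K ≤ (R ⊓ A) ⊔ (R ⊓ H) := by
    rintro r ⟨hr, hrK⟩
    obtain ⟨a, ha, h, hh, rfl⟩ := Subgroup.mem_sup_of_normal_left.1 hrK
    obtain ⟨k, hk⟩ := hPp a (hAP ha)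
    have hhc : h ^ Nat.card H = 1 := congrArg Subtype.val (pow_card_eq_one' (x := (⟨h, hh⟩ : H)))
    have haR : a ∈ R := part_mem R (hPH a (hAP ha) h hh) hk hhc (Nat.Coprime.pow_left k hHp.symm) hr
    have hhR : h ∈ R := (Subgroup.mul_mem_cancel_left R haR).1 hr
    exact Subgroup.mul_mem_sup ⟨haR, ha⟩ ⟨hhR, hh⟩
  have hmid : (L ⊓ K ⊔ (R ⊓ H)).relIndex (R ⊓ K) ≤
      Nat.card (R ⊓ A ⊓ Subgroup.centralizer {x} : Subgroup X) := by
    have hne : ∀ S T : Subgroup X, S.relIndex T ≠ 0 := fun S T => Subgroup.FiniteIndex.index_ne_zero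
    calc (L ⊓ K ⊔ (R ⊓ H)).relIndex (R ⊓ K)
        ≤ (L ⊓ K ⊔ (R ⊓ H)).relIndex (R ⊓ A ⊔ (L ⊓ K ⊔ (R ⊓ H))) := by
          refine Subgroup.relIndex_le_of_le_right (hdec.trans ?_) (hne _ _)
          exact sup_le le_sup_left (le_sup_right.trans le_sup_right)
      _ = (L ⊓ K ⊔ (R ⊓ H)).relIndex (R ⊓ A) := Subgroup.relIndex_sup_right _ _
      _ ≤ (L ⊓ K).relIndex (R ⊓ A) := Subgroup.relIndex_le_of_le_left le_sup_left (hne _ _)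
      _ ≤ _ := by
          have hcA : ∀ r ∈ R ⊓ A, ⁅r, x⁆ ∈ A := by
            rintro r ⟨_, hrA⟩
            have : ⁅r, x⁆ = r * (x * r⁻¹ * x⁻¹) := by simp [commutatorElement_def, mul_assoc]
            rw [this]
            exact A.mul_mem hrA (hAn.conj_mem _ (A.inv_mem hrA) x)
          refine comm_index_le (R ⊓ A) _ (fun a ha b hb => hAc a ha.2 b hb.2) x ?_ ?_
          · intro r hr
            exact ⟨hLR.1 (hLR.2 r hr.1 x), hcA r hr⟩
          · intro r hr
            exact ⟨hLR.2 r hr.1 x, (le_sup_left : A ≤ K) (hcA r hr)⟩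
  -- the pair in Y
  let Y := Subgroup.center X ⊔ H
  obtain ⟨C, hC⟩ : ∃ C : Subgroup X, C = R ⊓ A ⊓ Subgroup.centralizer {x} := ⟨_, rfl⟩
  rw [← hC] at hmid
  have hCc : C ≤ Subgroup.center X := by
    rw [hC, inf_assoc]
    exact inf_le_right.trans hcent
  have hCP : C ≤ P := by rw [hC]; exact (inf_le_left.trans inf_le_right).trans hAP
  have e3 : (L ⊓ H).relIndex (C ⊔ (R ⊓ H)) = (L ⊓ H).relIndex (R ⊓ H) * Nat.card C := by
    rw [← Subgroup.relIndex_mul_relIndex (L ⊓ H) (R ⊓ H) _ (inf_le_inf_right _ hLR.1) le_sup_right,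
      Subgroup.relIndex_sup_right]
    congr 1
    rw [← Subgroup.inf_relIndex_right]
    have : R ⊓ H ⊓ C = ⊥ := by
      rw [eq_bot_iff, ← hdis]
      exact le_inf (inf_le_right.trans hCP) (inf_le_left.trans inf_le_right)
    rw [this, Subgroup.relIndex_bot_left]
  have hTY : C ⊔ (R ⊓ H) ≤ Y := sup_le (hCc.trans le_sup_left) (inf_le_right.trans le_sup_right)
  have hfin : (L ⊓ H).relIndex (C ⊔ (R ⊓ H)) < Nat.card U := by
    rw [← Subgroup.relIndex_subgroupOf hTY]
    refine (ih Y U (subRep (ρ.comp Y.subtype : Representation ℤ Y V) U (fun y => hU y y.2)) rfl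
      (one_lt_card_sub U hUb) ((hco.restr Y).sub U _) _ _ ⟨?_, ?_⟩ ?_).1
    · exact Subgroup.comap_mono ((inf_le_inf_right _ hLR.1).trans le_sup_right)
    · rintro ⟨r, hrY⟩ hr ⟨y, hyY⟩
      rw [Subgroup.mem_subgroupOf] at hr ⊢
      simp only at hr
      show ⁅r, y⁆ ∈ L ⊓ H
      obtain ⟨c, hc, h, hh, rfl⟩ := Subgroup.mem_sup_of_normal_right.1 hr
      have hcy := Subgroup.mem_center_iff.1 (hCc hc)
      have h1 : ⁅c * h, y⁆ = ⁅h, y⁆ := by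
        have h2 : ⁅c * h, y⁆ = c * ⁅h, y⁆ * (y * c⁻¹ * y⁻¹) := by
          simp only [commutatorElement_def]; group
        have h3 : y * c⁻¹ * y⁻¹ = c⁻¹ := by
          have := hcy y⁻¹
          rw [mul_inv_eq_iff_eq_mul, mul_inv_eq_iff_eq_mul, mul_assoc, hcy y]; group
        rw [h2, h3, ← hcy]; group
      rw [h1]
      refine ⟨hLR.2 h hh.1 y, ?_⟩
      have : ⁅h, y⁆ = h * (y * h⁻¹ * y⁻¹) := by simp [commutatorElement_def, mul_assoc]
      rw [this]
      exact H.mul_mem hh.2 (hHn.conj_mem _ (H.inv_mem hh.2) y)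
    · rintro ⟨r, hrY⟩ hr hr1
      have hr1 : ∀ v ∈ U, ρ r v = v := fun v hv => congrArg Subtype.val (LinearMap.congr_fun hr1 ⟨v, hv⟩)
      -- the kernel on U is normal in X
      have : r = 1 := by
        let N : Subgroup X :=
          { carrier := {y | y ∈ Y ∧ ∀ v ∈ U, ρ y v = v}
            one_mem' := ⟨Y.one_mem, by simp⟩
            mul_mem' := by
              rintro a b ⟨ha, ha'⟩ ⟨hb, hb'⟩
              refine ⟨Y.mul_mem ha hb, fun v hv => ?_⟩
              rw [rep_mul, hb' v hv, ha' v hv]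
            inv_mem' := by
              rintro a ⟨ha, ha'⟩
              refine ⟨Y.inv_mem ha, fun v hv => ?_⟩
              conv_lhs => rw [← ha' v hv]
              rw [rep_inv_apply] }
        have hN : N.Normal := by
          constructor
          rintro n ⟨hn, hn'⟩ g
          have hg : g ∈ P ⊔ H := by rw [hsup]; trivial
          obtain ⟨a, ha, h, hh, rfl⟩ := Subgroup.mem_sup_of_normal_right.1 hg
          have hhY : h ∈ Y := Subgroup.mem_sup_right hh
          have h1 : h * n * h⁻¹ ∈ Y := Y.mul_mem (Y.mul_mem hhY hn) (Y.inv_mem hhY)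
          have h2 : a * (h * n * h⁻¹) = h * n * h⁻¹ * a := by
            obtain ⟨c, hc, k, hk, hck⟩ := Subgroup.mem_sup_of_normal_right.1 h1
            rw [← hck, ← mul_assoc, Subgroup.mem_center_iff.1 hc a, mul_assoc, hPH a ha k hk,
              mul_assoc]
          have h3 : a * h * n * (a * h)⁻¹ = h * n * h⁻¹ := by
            calc _ = a * (h * n * h⁻¹) * a⁻¹ := by group
              _ = _ := by rw [h2]; group
          rw [h3]
          refine ⟨h1, fun v hv => ?_⟩
          rw [rep_mul, rep_mul, hn' _ (hU _ (Y.inv_mem hhY) v hv), rep_apply_inv]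
        obtain ⟨v, hvU, hv0⟩ := (Submodule.ne_bot_iff U).1 hUb
        exact hfaith r (hirr.fix N hN hv0 (fun y hy => hy.2 v hvU) r ⟨hrY, hr1⟩)
      subst this
      exact Subgroup.one_mem _
  rw [e1, e2]
  refine Nat.mul_le_mul e1' ?_
  rw [e3] at hfin
  have : (L ⊓ K ⊔ R ⊓ H).relIndex (R ⊓ K) * (L ⊓ H).relIndex (R ⊓ H) ≤
      (L ⊓ H).relIndex (R ⊓ H) * Nat.card C := by
    rw [mul_comm]; exact Nat.mul_le_mul_left _ hmid
  omega


theorem sum_fixed {X : Type*} [Group X] {V : Type*} [AddCommGroup V] (ρ : Representation ℤ X V)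
    (y : X) (p : ℕ) (hy : y ^ p = 1) (v : V) :
    ρ y (∑ k ∈ Finset.range p, ρ (y ^ k) v) = ∑ k ∈ Finset.range p, ρ (y ^ k) v := by
  rw [map_sum]
  have h1 := Finset.sum_range_succ (fun k => ρ (y ^ k) v) p
  have h2 := Finset.sum_range_succ' (fun k => ρ (y ^ k) v) p
  rw [h1] at h2
  simp only [hy, pow_zero] at h2
  have h3 := add_right_cancel h2
  rw [h3]
  refine Finset.sum_congr rfl fun k _ => ?_
  rw [← rep_mul, pow_succ']

/-- eigenspace of `a` with eigenvalue `z ^ i` -/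
def eigS {X : Type*} [Group X] {V : Type*} [AddCommGroup V] (ρ : Representation ℤ X V)
    (a z : X) (i : ℕ) : Submodule ℤ V := LinearMap.eqLocus (ρ a) (ρ (z ^ i))

theorem mem_eigS {X : Type*} [Group X] {V : Type*} [AddCommGroup V] (ρ : Representation ℤ X V)
    (a z : X) (i : ℕ) (v : V) : v ∈ eigS ρ a z i ↔ ρ a v = ρ (z ^ i) v := Iff.rfl

theorem eigS_inv {X : Type*} [Group X] {V : Type*} [AddCommGroup V] (ρ : Representation ℤ X V)
    (a z : X) (hz : z ∈ Subgroup.center X) (i : ℕ) {m : X} (hm : m * a = a * m) {v : V}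
    (hv : v ∈ eigS ρ a z i) : ρ m v ∈ eigS ρ a z i := by
  rw [mem_eigS] at *
  rw [← rep_mul, ← hm, rep_mul, hv, ← rep_mul, ← rep_mul,
    ((show Commute m z from Subgroup.mem_center_iff.1 hz m).pow_right i).eq]

theorem eigS_shift {X : Type*} [Group X] {V : Type*} [AddCommGroup V] (ρ : Representation ℤ X V)
    (a z : X) (hz : z ∈ Subgroup.center X) (i : ℕ) {x : X} (hx : x * a = z * a * x) {v : V}
    (hv : v ∈ eigS ρ a z i) : ρ x⁻¹ v ∈ eigS ρ a z (i + 1) := by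
  rw [mem_eigS] at *
  have h1 : a * x⁻¹ = z * x⁻¹ * a := by
    have h0 : x⁻¹ * z = z * x⁻¹ := Subgroup.mem_center_iff.1 hz _
    rw [mul_inv_eq_iff_eq_mul, ← h0, mul_assoc, mul_assoc, ← mul_assoc z, ← hx,
      inv_mul_cancel_left]
  rw [← rep_mul, h1, rep_mul, hv, ← rep_mul, ← rep_mul]
  congr 2
  have h2 : x⁻¹ * z ^ i = z ^ i * x⁻¹ :=
    ((show Commute x⁻¹ z from Subgroup.mem_center_iff.1 hz _).pow_right i).eq
  rw [mul_assoc, h2, pow_succ', mul_assoc]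

theorem eigS_inter {X : Type*} [Group X] {V : Type*} [AddCommGroup V] {ρ : Representation ℤ X V}
    (hirr : Irr ρ) (hfaith : ∀ x, ρ x = 1 → x = 1)
    (a z : X) (hz : z ∈ Subgroup.center X) (hz1 : z ≠ 1) (i : ℕ) {v : V}
    (hv : v ∈ eigS ρ a z i) (hv' : v ∈ eigS ρ a z (i + 1)) : v = 0 := by
  rw [mem_eigS] at *
  rw [hv, pow_succ, rep_mul] at hv'
  exact hirr.fix_central hfaith hz hz1 (rep_inj ρ _ hv').symm

theorem eigS_zero_ne_bot {X : Type*} [Group X] {V : Type*} [AddCommGroup V] [Finite V]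
    [Nontrivial V] {ρ : Representation ℤ X V}
    (hirr : Irr ρ) (hfaith : ∀ x, ρ x = 1 → x = 1) (p : ℕ) (hp : p.Prime)
    (hpn : p.Coprime (Nat.card V))
    (a z : X) (hz : z ∈ Subgroup.center X) (hz1 : z ≠ 1) (hzp : z ^ p = 1) (hap : a ^ p = 1)
    {x : X} (hx : x * a = z * a * x) : ∃ v ∈ eigS ρ a z 0, v ≠ 0 := by
  have : Fact p.Prime := ⟨hp⟩
  have hzo : orderOf z = p := orderOf_eq_prime hzp hz1
  have key : ∃ i, ∃ v ∈ eigS ρ a z i, v ≠ 0 := by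
    by_contra! hall
    obtain ⟨v, hv⟩ := exists_ne (0 : V)
    apply hv
    have hcz : ∀ g, Commute g z := fun g => Subgroup.mem_center_iff.1 hz g
    have hN : ∀ i, ∑ k ∈ Finset.range p, ρ ((z ^ i * a) ^ k) v = 0 := by
      intro i
      have h1 : (z ^ i * a) ^ p = 1 := by
        rw [((hcz a).symm.pow_left i).mul_pow, hap, ← pow_mul, mul_comm, pow_mul, hzp]; simp
      have h2 := sum_fixed ρ _ p h1 v
      apply hall ((p - 1) * i)
      rw [mem_eigS]
      apply rep_inj ρ (z ^ i)
      rw [← rep_mul, h2, ← rep_mul, ← pow_add]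
      have : i + (p - 1) * i = p * i := by
        obtain ⟨q, hq⟩ := Nat.exists_eq_succ_of_ne_zero hp.ne_zero
        subst hq
        simp; ring
      rw [this, pow_mul, hzp]; simp
    have h3 : ∑ i ∈ Finset.range p, ∑ k ∈ Finset.range p, ρ ((z ^ i * a) ^ k) v = 0 :=
      Finset.sum_eq_zero fun i _ => hN i
    rw [Finset.sum_comm] at h3
    have h4 : ∀ k ∈ Finset.range p, k ≠ 0 → ∑ i ∈ Finset.range p, ρ ((z ^ i * a) ^ k) v = 0 := by
      intro k hk hk0
      have h5 : ∑ i ∈ Finset.range p, ρ ((z ^ i * a) ^ k) v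
          = ∑ i ∈ Finset.range p, ρ ((z ^ k) ^ i) (ρ (a ^ k) v) := by
        refine Finset.sum_congr rfl fun i _ => ?_
        rw [((hcz a).symm.pow_left i).mul_pow, rep_mul, ← pow_mul, ← pow_mul, mul_comm]
      rw [h5]
      refine hirr.fix_central hfaith (Subgroup.pow_mem _ hz k) ?_ (sum_fixed ρ _ p ?_ _)
      · intro h
        have := Nat.le_of_dvd (Nat.pos_of_ne_zero hk0) (orderOf_dvd_of_pow_eq_one h)
        rw [hzo] at this
        exact absurd (Finset.mem_range.1 hk) (by omega)
      · rw [← pow_mul, mul_comm, pow_mul, hzp, one_pow]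
    rw [Finset.sum_eq_single_of_mem 0 (Finset.mem_range.2 hp.pos) h4] at h3
    simp only [pow_zero, map_one, Finset.sum_const, Finset.card_range] at h3
    exact eq_zero_of_coprime_smul hpn h3
  obtain ⟨i, v, hv, hv0⟩ := key
  have hsh : ∀ j, ∃ w ∈ eigS ρ a z (i + j), w ≠ 0 := by
    intro j
    induction j with
    | zero => exact ⟨v, hv, hv0⟩
    | succ j ih =>
      obtain ⟨w, hw, hw0⟩ := ih
      refine ⟨ρ x⁻¹ w, eigS_shift ρ a z hz _ hx hw, fun h => hw0 ?_⟩
      apply rep_inj ρ x⁻¹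
      rw [h, map_zero]
  obtain ⟨w, hw, hw0⟩ := hsh ((p - 1) * i)
  refine ⟨w, ?_, hw0⟩
  rw [mem_eigS] at *
  have : i + (p - 1) * i = p * i := by
    obtain ⟨q, hq⟩ := Nat.exists_eq_succ_of_ne_zero hp.ne_zero
    subst hq
    simp; ring
  rw [hw, this, pow_mul, hzp]; simp


theorem cenPair_subgroupOf {X : Type*} [Group X] {L R : Subgroup X} (h : CenPair L R)
    (M : Subgroup X) : CenPair (L.subgroupOf M) (R.subgroupOf M) := by
  refine ⟨Subgroup.comap_mono h.1, fun r hr x => ?_⟩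
  exact h.2 r hr x

theorem three_indep {X : Type*} [Group X] {V : Type*} [AddCommGroup V] {ρ : Representation ℤ X V}
    (hirr : Irr ρ) (hfaith : ∀ x, ρ x = 1 → x = 1)
    (a z : X) (hz : z ∈ Subgroup.center X) (hz1 : z ≠ 1) (hz2 : z ^ 2 ≠ 1)
    (haz : a * z = z * a) {v₀ v₁ v₂ : V}
    (h0 : v₀ ∈ eigS ρ a z 0) (h1 : v₁ ∈ eigS ρ a z 1) (h2 : v₂ ∈ eigS ρ a z 2)
    (hs : v₀ + v₁ + v₂ = 0) : v₀ = 0 ∧ v₁ = 0 ∧ v₂ = 0 := by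
  have e0 : ρ a v₀ = v₀ := by simpa [mem_eigS] using h0
  have e1 : ρ a v₁ = ρ z v₁ := by simpa [mem_eigS] using h1
  have e2 : ρ a v₂ = ρ (z ^ 2) v₂ := h2
  have e3 : v₀ + ρ z v₁ + ρ (z ^ 2) v₂ = 0 := by
    have := congrArg (ρ a) hs
    rwa [map_add, map_add, map_zero, e0, e1, e2] at this
  have m1 : ρ z v₁ - v₁ ∈ eigS ρ a z 1 :=
    Submodule.sub_mem _ (eigS_inv ρ a z hz 1 haz.symm h1) h1
  have hz2m : (z ^ 2) * a = a * z ^ 2 := ((show Commute a z from haz).pow_right 2).eq.symm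
  have m2 : ρ (z ^ 2) v₂ - v₂ ∈ eigS ρ a z 2 :=
    Submodule.sub_mem _ (eigS_inv ρ a z hz 2 hz2m h2) h2
  have e4 : ρ z v₁ - v₁ = - (ρ (z ^ 2) v₂ - v₂) := by
    have : (v₀ + ρ z v₁ + ρ (z ^ 2) v₂) - (v₀ + v₁ + v₂) = 0 := by rw [hs, e3, sub_zero]
    rw [eq_neg_iff_add_eq_zero, ← this]; abel
  have e5 : ρ z v₁ - v₁ = 0 :=
    eigS_inter hirr hfaith a z hz hz1 1 m1 (by rw [e4]; exact Submodule.neg_mem _ m2)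
  have hv1 : v₁ = 0 := hirr.fix_central hfaith hz hz1 (sub_eq_zero.1 e5)
  have hv2 : v₂ = 0 := by
    refine hirr.fix_central hfaith (Subgroup.pow_mem _ hz 2) hz2 (sub_eq_zero.1 ?_)
    rw [e5] at e4
    exact neg_eq_zero.1 e4.symm
  refine ⟨?_, hv1, hv2⟩
  rw [hv1, hv2] at hs
  simpa using hs

theorem noncomm_on {X : Type*} [Group X] {V : Type*} [AddCommGroup V] {ρ : Representation ℤ X V}
    (hirr : Irr ρ) (hfaith : ∀ x, ρ x = 1 → x = 1) (A : Subgroup X) (hA : A.Normal)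
    (hnc : ¬ ∀ a ∈ A, ∀ b ∈ A, a * b = b * a) (W : Submodule ℤ V) (hW : ∃ v ∈ W, v ≠ 0) :
    ∃ x ∈ A, ∃ y ∈ A, ∃ v ∈ W, ρ ⁅x, y⁆ v ≠ v := by
  by_contra! hall
  apply hnc
  obtain ⟨v, hv, hv0⟩ := hW
  let S : Subgroup X :=
    { carrier := {g | ρ g v = v}
      one_mem' := by simp
      mul_mem' := by
        intro a b ha hb
        show ρ (a * b) v = v
        rw [rep_mul, show ρ b v = v from hb, show ρ a v = v from ha]
      inv_mem' := by
        intro a ha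
        show ρ a⁻¹ v = v
        conv_lhs => rw [← show ρ a v = v from ha]
        exact rep_inv_apply ρ a v }
  have h1 : ⁅A, A⁆ ≤ S := Subgroup.commutator_le.2 fun x hx y hy => hall x hx y hy v hv
  have h2 := hirr.fix ⁅A, A⁆ (Subgroup.commutator_normal A A) hv0 h1
  intro a ha b hb
  exact commutatorElement_eq_one_iff_mul_comm.1
    (hfaith _ (h2 _ (Subgroup.commutator_mem_commutator ha hb)))

theorem split_case {X : Type u} [Group X] [Finite X] [Group.IsNilpotent X] {V : Type v}
    [AddCommGroup V] [Finite V] [Nontrivial V] (ρ : Representation ℤ X V) (hco : CoAct ρ)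
    (hirr : Irr ρ)
    (hfaith : ∀ x, ρ x = 1 → x = 1) (ih : ∀ m < Nat.card V, StC.{u, v} m)
    (L R : Subgroup X) (hLR : CenPair L R)
    (p : ℕ) (hp : p.Prime) (P H : Subgroup X) (hPp : ∀ a ∈ P, ∃ k : ℕ, a ^ p ^ k = 1)
    (hHp : (Nat.card H).Coprime p) (hPn : P.Normal)
    (hPH : ∀ a ∈ P, ∀ b ∈ H, a * b = b * a) (hsup : P ⊔ H = ⊤) (hdis : P ⊓ H = ⊥)
    (hHn : H.Normal) (a z x0 : X) (haP : a ∈ P) (hx0 : x0 ∈ P) (hap : a ^ p = 1)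
    (hz : z ∈ Subgroup.center X) (hzp : z ^ p = 1) (hz1 : z ≠ 1) (hx : x0 * a = z * a * x0)
    (hall : ∀ x : X, ⁅x, a⁆ ∈ Subgroup.zpowers z) : p * L.relIndex R < Nat.card V := by
  have : Fact p.Prime := ⟨hp⟩
  have hLn : L.Normal := hLR.conj le_rfl hLR.1
  have hcz : ∀ g, Commute g z := fun g => Subgroup.mem_center_iff.1 hz g
  have hzo : orderOf z = p := orderOf_eq_prime hzp hz1
  have hpn : p.Coprime (Nat.card V) := by
    obtain ⟨m, hm, h1⟩ := hco z
    have := orderOf_dvd_of_pow_eq_one (hfaith _ h1)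
    rw [hzo] at this
    exact hm.coprime_dvd_left this
  have hzle : Subgroup.zpowers z ≤ Subgroup.center X := by simpa using hz
  let f : X →* X := MonoidHom.mk' (fun x : X => ⁅x, a⁆) (by
    intro x y
    rw [comm_mul_eq, Subgroup.mem_center_iff.1 (hzle (hall y)) x, mul_inv_cancel_right]
    exact Subgroup.mem_center_iff.1 (hzle (hall x)) _)
  have hf : ∀ x, f x = ⁅x, a⁆ := fun _ => rfl
  have hMm : ∀ x, x ∈ f.ker ↔ x * a = a * x := fun x => by
    rw [MonoidHom.mem_ker, hf, commutatorElement_eq_one_iff_mul_comm]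
  have hdvd : ∀ S : Subgroup X, f.ker.relIndex S ∣ p := by
    intro S
    rw [Subgroup.relIndex_ker, ← hzo, ← Nat.card_zpowers]
    apply Subgroup.card_dvd_of_le
    rintro _ ⟨x, _, rfl⟩
    exact hall x
  set M := f.ker with hM
  have hx0M : x0 ∉ M := by
    rw [hMm]
    intro h
    rw [h, mul_assoc, right_eq_mul] at hx
    exact hz1 hx
  have hMP : M.relIndex P = p := by
    rcases (Nat.dvd_prime hp).1 (hdvd P) with h | h
    · exact absurd (Subgroup.relIndex_eq_one.1 h hx0) hx0M
    · exact h
  have hMn : M.Normal := inferInstance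
  obtain ⟨v0, hv0, hv00⟩ := eigS_zero_ne_bot hirr hfaith p hp hpn a z hz hz1 hzp hap hx
  have hV1 : ∃ v ∈ eigS ρ a z 1, v ≠ 0 :=
    ⟨ρ x0⁻¹ v0, eigS_shift ρ a z hz 0 hx hv0, fun h => hv00 (rep_inj ρ x0⁻¹ (by rw [h, map_zero]))⟩
  set W := eigS ρ a z 0 with hWdef
  have hWb : W ≠ ⊥ := fun h => hv00 (by rw [h] at hv0; simpa using hv0)
  have hWt : W ≠ ⊤ := by
    intro h
    obtain ⟨v, hv, hvn⟩ := hV1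
    exact hvn (eigS_inter hirr hfaith a z hz hz1 0 (hWdef ▸ h ▸ Submodule.mem_top) hv)
  have hAn : (M ⊓ P).Normal := Subgroup.normal_inf_normal M P
  have hcardW := card_sub_lt W hWt
  by_cases hnc : ∀ x ∈ M ⊓ P, ∀ y ∈ M ⊓ P, x * y = y * x
  · -- abelian case
    have hYM : Subgroup.center X ⊔ H ≤ M := by
      refine sup_le (fun g hg => ?_) fun g hg => ?_
      · rw [hMm]; exact (Subgroup.mem_center_iff.1 hg a).symm
      · rw [hMm]; exact (hPH a haP g hg).symm
    obtain ⟨h1, h2⟩ := lemma_b ρ hco hirr hfaith L R hLR p hp P H hPp hHp hPH hsup hdis hHn (M ⊓ P)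
      inf_le_right hAn (by rw [Subgroup.inf_relIndex_right]; exact hMP) hnc W
      (fun y hy v hv => eigS_inv ρ a z hz 0 ((hMm y).1 (hYM hy)) hv) hWb (ih _ hcardW) z hz hzp hz1
    by_cases hp2 : p = 2
    · have hsq : Nat.card W * Nat.card W ≤ Nat.card V := by
        rw [← Nat.card_prod]
        refine Nat.card_le_card_of_injective (fun t : W × W => (t.1 : V) + ρ x0⁻¹ t.2) ?_
        rintro ⟨s, t⟩ ⟨s', t'⟩ h
        have h : (s : V) + ρ x0⁻¹ t = s' + ρ x0⁻¹ t' := h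
        have e1 : (s : V) - s' = ρ x0⁻¹ ((t' : V) - t) := by
          rw [map_sub, sub_eq_sub_iff_add_eq_add, h, add_comm]
        have e2 : (s : V) - s' = 0 := eigS_inter hirr hfaith a z hz hz1 0
          (Submodule.sub_mem _ s.2 s'.2)
          (by rw [e1]; exact eigS_shift ρ a z hz 0 hx (Submodule.sub_mem _ t'.2 t.2))
        have e3 : (t' : V) - t = 0 := rep_inj ρ x0⁻¹ (by rw [← e1, e2, map_zero])
        exact Prod.ext (Subtype.ext (sub_eq_zero.1 e2)) (Subtype.ext (sub_eq_zero.1 e3).symm)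
      subst hp2
      obtain ⟨w, hw⟩ := Nat.exists_eq_add_of_le h2
      rw [hw] at h1 hsq
      have : 2 + 1 + w - 1 = w + 2 := by omega
      rw [this] at h1
      nlinarith
    · have hp3 : 3 ≤ p := by have := hp.two_le; omega
      have hz2 : z ^ 2 ≠ 1 := by
        intro h
        have := Nat.le_of_dvd (by norm_num) (orderOf_dvd_of_pow_eq_one h)
        omega
      have hcu : Nat.card W * (Nat.card W * Nat.card W) ≤ Nat.card V := by
        rw [← Nat.card_prod, ← Nat.card_prod]
        refine Nat.card_le_card_of_injective
          (fun t : W × W × W => (t.1 : V) + ρ x0⁻¹ t.2.1 + ρ x0⁻¹ (ρ x0⁻¹ t.2.2)) ?_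
        rintro ⟨s, t, w⟩ ⟨s', t', w'⟩ h
        have h : (s : V) + ρ x0⁻¹ t + ρ x0⁻¹ (ρ x0⁻¹ w)
          = s' + ρ x0⁻¹ t' + ρ x0⁻¹ (ρ x0⁻¹ w') := h
        obtain ⟨e1, e2, e3⟩ := three_indep hirr hfaith a z hz hz1 hz2 (hcz a)
          (v₀ := (s : V) - s') (v₁ := ρ x0⁻¹ ((t : V) - t'))
          (v₂ := ρ x0⁻¹ (ρ x0⁻¹ ((w : V) - w')))
          (Submodule.sub_mem _ s.2 s'.2)
          (eigS_shift ρ a z hz 0 hx (Submodule.sub_mem _ t.2 t'.2))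
          (eigS_shift ρ a z hz 1 hx (eigS_shift ρ a z hz 0 hx (Submodule.sub_mem _ w.2 w'.2)))
          (by
            simp only [map_sub]
            rw [← sub_eq_zero] at h
            rw [← h]; abel)
        have e2 : (t : V) - t' = 0 := rep_inj ρ x0⁻¹ (by rw [e2, map_zero])
        have e3 : (w : V) - w' = 0 := rep_inj ρ x0⁻¹ (rep_inj ρ x0⁻¹ (by rw [e3, map_zero, map_zero]))
        refine Prod.ext (Subtype.ext (sub_eq_zero.1 e1)) (Prod.ext (Subtype.ext (sub_eq_zero.1 e2))
          (Subtype.ext (sub_eq_zero.1 e3)))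
      obtain ⟨w, hw⟩ := Nat.exists_eq_add_of_le h2
      rw [hw] at h1 hcu
      have : p + 1 + w - 1 = p + w := by omega
      rw [this] at h1
      have h5 : p * L.relIndex R ≤ p * (p * (p + w)) := Nat.mul_le_mul_left p h1
      have h6 : p * (p * (p + w)) ≤ (p + w) * ((p + w) * (p + w)) := by gcongr <;> omega
      have h7 : (p + w) * ((p + w) * (p + w)) < (p + 1 + w) * ((p + 1 + w) * (p + 1 + w)) := by
        nlinarith
      omega
  · -- nonabelian case
    have hR : L.relIndex R ≤ p * (L.subgroupOf M).relIndex (R.subgroupOf M) := by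
      rw [relIndex_split L R M hLR.1]
      have e1 : (L.subgroupOf M).relIndex (R.subgroupOf M) = (L ⊓ M).relIndex (R ⊓ M) := by
        rw [← Subgroup.inf_subgroupOf_right L, ← Subgroup.inf_subgroupOf_right R,
          Subgroup.relIndex_subgroupOf inf_le_right]
      rw [e1]
      apply Nat.mul_le_mul_right
      have e2 : (L ⊔ (R ⊓ M)).relIndex R ∣ (R ⊓ M).relIndex R :=
        Subgroup.relIndex_dvd_of_le_left R le_sup_right
      rw [Subgroup.inf_relIndex_left] at e2
      exact Nat.le_of_dvd hp.pos (e2.trans (hdvd R))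
    have hWinv : ∀ m : M, ∀ v ∈ W, (ρ.comp M.subtype : Representation ℤ M V) m v ∈ W :=
      fun m v hv => eigS_inv ρ a z hz 0 ((hMm m).1 m.2) hv
    obtain ⟨L1, R1, L2, R2, hc1, hc2, hf1, hf2, hprod⟩ :=
      split_pair (ρ.comp M.subtype : Representation ℤ M V) (hco.restr M) W hWinv
        (L.subgroupOf M) (R.subgroupOf M) (cenPair_subgroupOf hLR M) (by
          intro r hr h
          have : r = 1 := Subtype.ext (hfaith _ h)
          rw [this]; exact one_mem _)
    have hi1 := (ih _ hcardW M W (subRep _ W hWinv) rfl (one_lt_card_sub W hWb)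
      ((hco.restr M).sub W hWinv) L1 R1 hc1 hf1).2 p hp (by
        obtain ⟨x, hx, y, hy, v, hv, hne⟩ := noncomm_on hirr hfaith (M ⊓ P) hAn hnc W ⟨v0, hv0, hv00⟩
        obtain ⟨k, hk⟩ := hPp x hx.2
        obtain ⟨l, hl⟩ := hPp y hy.2
        refine ⟨⟨x, hx.1⟩, ⟨y, hy.1⟩, ⟨k, Subtype.ext hk⟩, ⟨l, Subtype.ext hl⟩, fun h => hne ?_⟩
        exact congrArg Subtype.val (LinearMap.congr_fun h ⟨v, hv⟩))
    have hi2 := (ih _ (card_quot_lt W hWb) M (V ⧸ W) (quotRep _ W hWinv) rfl (one_lt_card_quot W hWt)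
      ((hco.restr M).quot W hWinv) L2 R2 hc2 hf2).2 p hp (by
        obtain ⟨x, hx, y, hy, v, hv, hne⟩ := noncomm_on hirr hfaith (M ⊓ P) hAn hnc _ hV1
        obtain ⟨k, hk⟩ := hPp x hx.2
        obtain ⟨l, hl⟩ := hPp y hy.2
        refine ⟨⟨x, hx.1⟩, ⟨y, hy.1⟩, ⟨k, Subtype.ext hk⟩, ⟨l, Subtype.ext hl⟩, fun h => hne ?_⟩
        have h1 : ρ ⁅x, y⁆ v - v ∈ W := (quotRep_one_iff _ W hWinv _).1 h v
        have h2 : ⁅x, y⁆ ∈ M := by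
          have := (⁅(⟨x, hx.1⟩ : M), (⟨y, hy.1⟩ : M)⁆).2
          exact this
        have h3 : ρ ⁅x, y⁆ v - v ∈ eigS ρ a z 1 :=
          Submodule.sub_mem _ (eigS_inv ρ a z hz 1 ((hMm _).1 h2) hv) hv
        exact sub_eq_zero.1 (eigS_inter hirr hfaith a z hz hz1 0 h1 h3))
    rw [hprod] at hR
    rw [Submodule.card_eq_card_quotient_mul_card W]
    calc p * L.relIndex R ≤ p * (p * (L1.relIndex R1 * L2.relIndex R2)) := Nat.mul_le_mul_left p hR
      _ = (p * L1.relIndex R1) * (p * L2.relIndex R2) := by ring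
      _ < _ := Nat.mul_lt_mul'' hi1 hi2


theorem cyc_mem {C : Type*} [Group C] [Finite C] [IsCyclic C] (p : ℕ) (hp : p.Prime) (z c : C)
    (hz1 : z ≠ 1) (hz : z ^ p = 1) (hc : c ^ p = 1) : c ∈ Subgroup.zpowers z := by
  classical
  have : Fact p.Prime := ⟨hp⟩
  have := Fintype.ofFinite C
  have h1 := IsCyclic.card_pow_eq_one_le (α := C) (n := p) hp.pos
  have h2 : (Finset.univ.filter (fun a : C => a ∈ Subgroup.zpowers z)) ⊆
      Finset.univ.filter (fun a : C => a ^ p = 1) := by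
    intro a ha
    simp only [Finset.mem_filter, Finset.mem_univ, true_and] at ha ⊢
    obtain ⟨i, rfl⟩ := ha
    show (z ^ i) ^ p = 1
    rw [← zpow_natCast, ← zpow_mul, mul_comm, zpow_mul, zpow_natCast, hz, one_zpow]
  have h3 : (Finset.univ.filter (fun a : C => a ∈ Subgroup.zpowers z)).card = p := by
    rw [← Fintype.card_subtype, ← Nat.card_eq_fintype_card]
    exact (Nat.card_zpowers z).trans (orderOf_eq_prime hz hz1)
  have h4 := Finset.eq_of_subset_of_card_le h2 (by rw [h3]; exact h1)
  have h5 : c ∈ Finset.univ.filter (fun a : C => a ^ p = 1) := by simpa using hc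
  rw [← h4] at h5
  simpa using h5

theorem comm_pow_one {X : Type*} [Group X] (x a : X) (p : ℕ) (hc : Commute ⁅x, a⁆ a)
    (ha : a ^ p = 1) : ⁅x, a⁆ ^ p = 1 := by
  have h1 : ⁅x, a⁆ * a = x * a * x⁻¹ := by simp [commutatorElement_def]
  have h2 : (⁅x, a⁆ * a) ^ p = 1 := by
    rw [h1, conj_pow, ha]; simp
  rwa [hc.mul_pow, ha, mul_one] at h2

theorem nonsplit_case {X : Type u} [Group X] [Finite X] [Group.IsNilpotent X] {V : Type v}
    [AddCommGroup V] [Finite V] [Nontrivial V] (ρ : Representation ℤ X V) (hco : CoAct ρ)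
    (hirr : Irr ρ)
    (hfaith : ∀ x, ρ x = 1 → x = 1) (ih : ∀ m < Nat.card V, StC.{u, v} m)
    (L R : Subgroup X) (hLR : CenPair L R)
    (P H : Subgroup X) (hPp : ∀ a ∈ P, ∃ k : ℕ, a ^ 2 ^ k = 1)
    (hHp : (Nat.card H).Coprime 2)
    (hPH : ∀ a ∈ P, ∀ b ∈ H, a * b = b * a) (hsup : P ⊔ H = ⊤) (hdis : P ⊓ H = ⊥)
    (hHn : H.Normal) (A : Subgroup X) (hAP : A ≤ P) (hAn : A.Normal) (hAi : A.relIndex P = 2)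
    (hAc : ∀ a ∈ A, ∀ b ∈ A, a * b = b * a)
    (hPc : ¬ ∀ a ∈ P, ∀ b ∈ P, a * b = b * a) (z : X)
    (hz : z ∈ Subgroup.center X) (hzp : z ^ 2 = 1) (hz1 : z ≠ 1) :
    2 * L.relIndex R < Nat.card V := by
  have hYP : ∀ y ∈ Subgroup.center X ⊔ H, ∀ a ∈ P, a * y = y * a := by
    intro y hy a ha
    have : Subgroup.center X ⊔ H ≤ Subgroup.centralizer {a} := by
      refine sup_le (fun g hg => ?_) fun g hg => ?_
      · rw [Subgroup.mem_centralizer_iff]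
        rintro _ rfl
        exact Subgroup.mem_center_iff.1 hg _
      · rw [Subgroup.mem_centralizer_iff]
        rintro _ rfl
        exact hPH _ ha g hg
    exact Subgroup.mem_centralizer_iff.1 (this hy) a rfl
  obtain ⟨W, hWi, hWb, hWt⟩ : ∃ W : Submodule ℤ V,
      (∀ y ∈ Subgroup.center X ⊔ H, ∀ v ∈ W, ρ y v ∈ W) ∧ W ≠ ⊥ ∧ W ≠ ⊤ := by
    by_contra! hall
    apply hPc
    have hcyc : IsCyclic P := schur_cyclic
      (ρ.comp (Subgroup.center X ⊔ H).subtype : Representation ℤ ↥(Subgroup.center X ⊔ H) V)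
      (fun W hW => by
        by_cases hb : W = ⊥
        · exact Or.inl hb
        · exact Or.inr (hall W (fun y hy v hv => hW ⟨y, hy⟩ v hv) hb))
      (ρ.comp P.subtype)
      (by
        rw [injective_iff_map_eq_one]
        intro a ha
        exact Subtype.ext (hfaith _ ha))
      (by
        intro a y v
        show ρ a (ρ y v) = ρ y (ρ a v)
        rw [← rep_mul, ← rep_mul, hYP y y.2 a a.2])
    intro a ha b hb
    have := (IsCyclic.commGroup (α := P)).mul_comm ⟨a, ha⟩ ⟨b, hb⟩
    exact congrArg Subtype.val this
  obtain ⟨U, ⟨hUi, hUb⟩, hUmin⟩ := Set.Finite.exists_minimal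
    (s := {U : Submodule ℤ V | (∀ y ∈ Subgroup.center X ⊔ H, ∀ v ∈ U, ρ y v ∈ U) ∧ U ≠ ⊥})
    (Set.toFinite _) ⟨W, hWi, hWb⟩
  have hUt : U ≠ ⊤ := by
    intro h
    have := hUmin ⟨hWi, hWb⟩ (h ▸ le_top)
    exact hWt (top_le_iff.1 (h ▸ this))
  obtain ⟨g, hg, v1, hv1, hgv⟩ : ∃ g ∈ P, ∃ v ∈ U, ρ g v ∉ U := by
    by_contra! hall
    rcases hirr U (by
      intro x v hv
      have hx : x ∈ P ⊔ H := hsup ▸ Subgroup.mem_top x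
      obtain ⟨a, ha, b, hb, rfl⟩ := Subgroup.mem_sup_of_normal_right.1 hx
      rw [rep_mul]
      exact hall a ha _ (hUi b (Subgroup.mem_sup_right hb) v hv)) with h | h
    · exact hUb h
    · exact hUt h
  have hinter : ∀ w ∈ U, ρ g w ∈ U → w = 0 := by
    by_contra! hne
    obtain ⟨w, hw, hgw, hw0⟩ := hne
    have := @hUmin (U ⊓ U.comap (ρ g)) ⟨by
      intro y hy v hv
      refine ⟨hUi y hy v hv.1, ?_⟩
      show ρ g (ρ y v) ∈ U
      rw [← rep_mul, hYP y hy g hg, rep_mul]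
      exact hUi y hy _ hv.2, by
      intro h
      have : w ∈ U ⊓ U.comap (ρ g) := ⟨hw, hgw⟩
      rw [h] at this
      exact hw0 (by simpa using this)⟩ inf_le_left
    exact hgv (this hv1).2
  have hsq : Nat.card U * Nat.card U ≤ Nat.card V := by
    rw [← Nat.card_prod]
    refine Nat.card_le_card_of_injective (fun t : U × U => (t.1 : V) + ρ g t.2) ?_
    rintro ⟨s, t⟩ ⟨s', t'⟩ h
    have h : (s : V) + ρ g t = s' + ρ g t' := h
    have e1 : (s : V) - s' = ρ g ((t' : V) - t) := by
      rw [map_sub, sub_eq_sub_iff_add_eq_add, h, add_comm]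
    have e3 : (t' : V) - t = 0 := hinter _ (Submodule.sub_mem _ t'.2 t.2)
      (by rw [← e1]; exact Submodule.sub_mem _ s.2 s'.2)
    have e2 : (s : V) - s' = 0 := by rw [e1, e3, map_zero]
    exact Prod.ext (Subtype.ext (sub_eq_zero.1 e2)) (Subtype.ext (sub_eq_zero.1 e3).symm)
  obtain ⟨h1, h2⟩ := lemma_b ρ hco hirr hfaith L R hLR 2 Nat.prime_two P H hPp hHp hPH hsup hdis hHn
    A hAP hAn hAi hAc U hUi hUb (ih _ (card_sub_lt U hUt)) z hz hzp hz1
  obtain ⟨w, hw⟩ := Nat.exists_eq_add_of_le h2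
  rw [hw] at h1 hsq
  have : 2 + 1 + w - 1 = w + 2 := by omega
  rw [this] at h1
  nlinarith

theorem irr_faithful {X : Type u} [Group X] [Finite X] [Group.IsNilpotent X] {V : Type v}
    [AddCommGroup V] [Finite V] [Nontrivial V] (ρ : Representation ℤ X V) (hco : CoAct ρ)
    (hirr : Irr ρ)
    (hfaith : ∀ x, ρ x = 1 → x = 1) (ih : ∀ m < Nat.card V, StC.{u, v} m)
    (L R : Subgroup X) (hLR : CenPair L R)
    (p : ℕ) (hp : p.Prime) (x y : X) (hx : ∃ k : ℕ, x ^ p ^ k = 1) (hy : ∃ k : ℕ, y ^ p ^ k = 1)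
    (hxy : x * y ≠ y * x) : p * L.relIndex R < Nat.card V := by
  have : Fact p.Prime := ⟨hp⟩
  obtain ⟨P⟩ : Nonempty (Sylow p X) := inferInstance
  obtain ⟨H, hHn, hHp, hPH, hsup, hcompl, hmem⟩ := nil_decomp p P
  have hPp : ∀ a ∈ (P : Subgroup X), ∃ k : ℕ, a ^ p ^ k = 1 := by
    intro a ha
    obtain ⟨k, hk⟩ := P.isPGroup' ⟨a, ha⟩
    exact ⟨k, congrArg Subtype.val hk⟩
  have hPn : (P : Subgroup X).Normal := by
    constructor
    intro a ha g
    obtain ⟨k, hk⟩ := hPp a ha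
    exact hmem _ ⟨k, by rw [conj_pow, hk]; simp⟩
  have hdis : (P : Subgroup X) ⊓ H = ⊥ := hcompl.disjoint.eq_bot
  have hcen : ∀ a ∈ (P : Subgroup X), (∀ b ∈ (P : Subgroup X), a * b = b * a) →
      a ∈ Subgroup.center X := by
    intro a ha h
    rw [Subgroup.mem_center_iff]
    intro g
    have hg : g ∈ (P : Subgroup X) ⊔ H := hsup ▸ Subgroup.mem_top g
    obtain ⟨b, hb, c, hc, rfl⟩ := Subgroup.mem_sup_of_normal_right.1 hg
    rw [mul_assoc, ← hPH a ha c hc, ← mul_assoc, ← h b hb, mul_assoc]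
  have hcen' : ∀ a : P, a ∈ Subgroup.center P → (a : X) ∈ Subgroup.center X := by
    intro a ha
    refine hcen a a.2 fun b hb => ?_
    exact (congrArg Subtype.val (Subgroup.mem_center_iff.1 ha ⟨b, hb⟩)).symm
  have hxP := hmem x hx
  have hyP := hmem y hy
  have hcyc : IsCyclic (Subgroup.center P) := schur_cyclic ρ hirr
    (ρ.comp ((P : Subgroup X).subtype.comp (Subgroup.center P).subtype))
    (by
      rw [injective_iff_map_eq_one]
      intro a ha
      exact Subtype.ext (Subtype.ext (hfaith _ ha)))
    (by
      intro a y v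
      show ρ ((a : P) : X) (ρ y v) = ρ y (ρ ((a : P) : X) v)
      rw [← rep_mul, ← rep_mul, Subgroup.mem_center_iff.1 (hcen' a a.2) y])
  by_cases hs : ∀ a : P, a ^ p = 1 → (∀ x : P, ⁅a, x⁆ ∈ Subgroup.center P) → a ∈ Subgroup.center P
  · obtain ⟨h2, A, hAi, hAc⟩ := lemmaN p P.isPGroup'
      ⟨⟨x, hxP⟩, ⟨y, hyP⟩, fun h => hxy (congrArg Subtype.val h)⟩ hcyc hs
    subst h2
    have hPnt : Nontrivial P := ⟨⟨⟨x, hxP⟩, 1, fun h => hxy (by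
      have : x = 1 := congrArg Subtype.val h
      simp [this])⟩⟩
    obtain ⟨z, hz1, hzp⟩ : ∃ z : Subgroup.center P, z ≠ 1 ∧ z ^ 2 = 1 := by
      have hnt : Nontrivial (Subgroup.center P) := P.isPGroup'.center_nontrivial
      have hpg : IsPGroup 2 (Subgroup.center P) := P.isPGroup'.to_subgroup _
      obtain ⟨k, hk0, hk⟩ := hpg.nontrivial_iff_card.1 hnt
      obtain ⟨z, hz⟩ := exists_prime_orderOf_dvd_card' (G := Subgroup.center P) 2
        (by rw [hk]; exact dvd_pow_self 2 hk0.ne')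
      refine ⟨z, fun h => ?_, orderOf_dvd_iff_pow_eq_one.1 (dvd_of_eq hz)⟩
      rw [h] at hz; simp at hz
    have hAn : A.Normal := Subgroup.normal_of_index_eq_two hAi
    refine nonsplit_case ρ hco hirr hfaith ih L R hLR P H hPp hHp hPH hsup hdis hHn
      (A.map (P : Subgroup X).subtype) (Subgroup.map_subtype_le A) ?_ ?_ ?_ ?_ ((z : P) : X)
      (hcen' z z.2) ?_ ?_
    · constructor
      rintro _ ⟨a, ha, rfl⟩ g
      have hg : g ∈ (P : Subgroup X) ⊔ H := hsup ▸ Subgroup.mem_top g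
      obtain ⟨b, hb, c, hc, rfl⟩ := Subgroup.mem_sup_of_normal_right.1 hg
      refine ⟨⟨b, hb⟩ * a * ⟨b, hb⟩⁻¹, hAn.conj_mem a ha _, ?_⟩
      show b * a * b⁻¹ = b * c * a * (b * c)⁻¹
      have := hPH a a.2 c hc
      rw [mul_assoc b c, ← this]; group
    · refine Eq.trans ?_ hAi
      rw [Subgroup.relIndex]
      congr 1
      exact Subgroup.comap_map_eq_self_of_injective (P : Subgroup X).subtype_injective A
    · rintro _ ⟨a, ha, rfl⟩ _ ⟨b, hb, rfl⟩
      exact congrArg Subtype.val (hAc a ha b hb)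
    · intro h; exact hxy (h x hxP y hyP)
    · exact congrArg (fun t : Subgroup.center P => ((t : P) : X)) hzp
    · intro h; exact hz1 (Subtype.ext (Subtype.ext h))
  · push Not at hs
    obtain ⟨a, hap, hac, hanc⟩ := hs
    have hac' : ∀ b : P, ⁅b, a⁆ ∈ Subgroup.center P := by
      intro b
      rw [← commutatorElement_inv]
      exact inv_mem (hac b)
    have hpow : ∀ b : P, ⁅b, a⁆ ^ p = 1 := fun b =>
      comm_pow_one b a p (Subgroup.mem_center_iff.1 (hac' b) a).symm hap
    obtain ⟨x0, hx0⟩ : ∃ x0 : P, ⁅x0, a⁆ ≠ 1 := by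
      by_contra! h
      apply hanc
      refine Subgroup.mem_center_iff.2 fun g => ?_
      exact commutatorElement_eq_one_iff_mul_comm.1 (h g)
    have hpowers : ∀ b : P, ⁅b, a⁆ ∈ Subgroup.zpowers ⁅x0, a⁆ := by
      intro b
      obtain ⟨i, hi⟩ := cyc_mem p hp (⟨⁅x0, a⁆, hac' x0⟩ : Subgroup.center P) ⟨⁅b, a⁆, hac' b⟩
        (fun h => hx0 (congrArg Subtype.val h)) (Subtype.ext (hpow x0)) (Subtype.ext (hpow b))
      exact ⟨i, congrArg Subtype.val hi⟩
    refine split_case ρ hco hirr hfaith ih L R hLR p hp P H hPp hHp hPn hPH hsup hdis hHn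
      (a : X) ((⁅x0, a⁆ : P) : X) (x0 : X) a.2 x0.2 (congrArg Subtype.val hap)
      (hcen' _ (hac' x0)) (congrArg Subtype.val (hpow x0)) (fun h => hx0 (Subtype.ext h)) ?_ ?_
    · show (x0 : X) * a = ⁅(x0 : X), (a : X)⁆ * a * x0
      simp [commutatorElement_def]
    · intro g
      have hg : g ∈ (P : Subgroup X) ⊔ H := hsup ▸ Subgroup.mem_top g
      obtain ⟨b, hb, c, hc, rfl⟩ := Subgroup.mem_sup_of_normal_right.1 hg
      obtain ⟨i, hi⟩ := hpowers ⟨b, hb⟩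
      refine ⟨i, ?_⟩
      have h1 : ⁅c, (a : X)⁆ = 1 := commutatorElement_eq_one_iff_mul_comm.2 (hPH a a.2 c hc).symm
      rw [comm_mul_eq, h1]
      simp only [mul_one, mul_inv_cancel, one_mul]
      exact congrArg Subtype.val hi


theorem stC_faithful {X : Type u} [Group X] [Finite X] [Group.IsNilpotent X] {V : Type v}
    [AddCommGroup V] [Finite V] [Nontrivial V] (ρ : Representation ℤ X V) (hco : CoAct ρ)
    (hirr : Irr ρ)
    (hfaith : ∀ x, ρ x = 1 → x = 1) (ih : ∀ m < Nat.card V, StC.{u, v} m)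
    (L R : Subgroup X) (hLR : CenPair L R) : L.relIndex R < Nat.card V ∧ ∀ p : ℕ, p.Prime →
        (∃ x y : X, (∃ k : ℕ, x ^ p ^ k = 1) ∧ (∃ k : ℕ, y ^ p ^ k = 1) ∧ ρ ⁅x, y⁆ ≠ 1) →
        p * L.relIndex R < Nat.card V := by
  constructor
  · by_cases hab : ∀ x y : X, x * y = y * x
    · exact stC_abelian ρ hirr hfaith hab L R
    · obtain ⟨p, hp, x, y, hx, hy, hxy⟩ := exists_p_noncomm hab
      have := irr_faithful ρ hco hirr hfaith ih L R hLR p hp x y hx hy hxy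
      have := Nat.le_mul_of_pos_left (L.relIndex R) hp.pos
      omega
  · rintro p hp ⟨x, y, hx, hy, hxy⟩
    refine irr_faithful ρ hco hirr hfaith ih L R hLR p hp x y hx hy fun h => hxy ?_
    rw [commutatorElement_eq_one_iff_mul_comm.2 h, map_one]

theorem theoremC (n : ℕ) : StC.{u, v} n := by
  induction n using Nat.strong_induction_on with
  | _ n ih =>
  intro X _ _ _ V _ _ ρ hn h1n hco L R hLR hf
  by_cases hred : ∃ W : Submodule ℤ V, (∀ x, ∀ v ∈ W, ρ x v ∈ W) ∧ W ≠ ⊥ ∧ W ≠ ⊤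
  · obtain ⟨W, hW, hb, ht⟩ := hred
    exact stC_reducible n ih X V ρ hn hco L R hLR hf W hW hb ht
  have hirr : Irr ρ := by
    intro W hW
    by_contra! h
    exact hred ⟨W, hW, h.1, h.2⟩
  subst hn
  have : Nontrivial V := Finite.one_lt_card_iff_nontrivial.1 h1n
  have hLn : L.Normal := hLR.conj le_rfl hLR.1
  let K : Subgroup X := MonoidHom.ker ρ
  have hKn : K.Normal := MonoidHom.normal_ker ρ
  let σ : Representation ℤ (X ⧸ K) V := QuotientGroup.lift K ρ le_rfl
  let π : X →* X ⧸ K := QuotientGroup.mk' K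
  have hπ : Function.Surjective π := QuotientGroup.mk'_surjective K
  have hσ : ∀ x, σ (π x) = ρ x := fun x => rfl
  have hsco : CoAct σ := by
    intro q
    obtain ⟨x, rfl⟩ := hπ q
    obtain ⟨m, hm, h⟩ := hco x
    exact ⟨m, hm, by rw [← map_pow, hσ, h]⟩
  have hsirr : Irr σ := fun W hW => hirr W fun x v hv => hW (π x) v hv
  have hsf : ∀ q, σ q = 1 → q = 1 := by
    intro q hq
    obtain ⟨x, rfl⟩ := hπ q
    exact (QuotientGroup.eq_one_iff x).2 hq
  have hcen : CenPair (L.map π) (R.map π) := by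
    refine ⟨Subgroup.map_mono hLR.1, ?_⟩
    rintro _ ⟨r, hr, rfl⟩ q
    obtain ⟨x, rfl⟩ := hπ q
    exact ⟨⁅r, x⁆, hLR.2 r hr x, map_commutatorElement π r x⟩
  have hle : L.relIndex R = (L.map π).relIndex (R.map π) := by
    rw [← Subgroup.relIndex_comap, Subgroup.comap_map_eq, QuotientGroup.ker_mk']
    rw [← Subgroup.inf_relIndex_right (L ⊔ K)]
    congr 1
    apply le_antisymm
    · exact le_inf le_sup_left hLR.1
    · rintro x ⟨hx, hxR⟩
      obtain ⟨l, hl, k, hk, rfl⟩ := Subgroup.mem_sup_of_normal_left.1 hx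
      have hkR : k ∈ R := by
        have := R.mul_mem (R.inv_mem (hLR.1 hl)) hxR
        rwa [inv_mul_cancel_left] at this
      exact L.mul_mem hl (hf k hkR hk)
  obtain ⟨hA, hB⟩ := stC_faithful σ hsco hsirr hsf ih (L.map π) (R.map π) hcen
  rw [hle]
  refine ⟨hA, ?_⟩
  rintro p hp ⟨x, y, ⟨k, hx⟩, ⟨l, hy⟩, hxy⟩
  refine hB p hp ⟨π x, π y, ⟨k, by rw [← map_pow, hx, map_one]⟩, ⟨l, by rw [← map_pow, hy, map_one]⟩, ?_⟩
  rwa [← map_commutatorElement, hσ]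

theorem card_ab (G : Type*) [Group G] : Nat.card (Abelianization G) = (commutator G).index := rfl

theorem card_ab_sub {G : Type*} [Group G] (H : Subgroup G) :
    Nat.card (Abelianization H) = ⁅H, H⁆.relIndex H := by
  rw [card_ab, ← Subgroup.map_subtype_commutator, Subgroup.relIndex]
  congr 1
  exact (Subgroup.comap_map_eq_self_of_injective H.subtype_injective _).symm

theorem card_ab_congr {G K : Type*} [Group G] [Group K] (e : G ≃* K) :
    Nat.card (Abelianization G) = Nat.card (Abelianization K) :=
  Nat.card_congr e.abelianizationCongr.toEquiv

theorem wt_congr {G K : Type*} [Group G] [Group K] (e : G ≃* K) (h : IsWeaklyTop G) :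
    IsWeaklyTop K := by
  intro J
  rw [← card_ab_congr e,
    card_ab_congr (J.equivMapOfInjective e.symm.toMonoidHom e.symm.injective)]
  exact h _

theorem card_ab_prod (A B : Type*) [Group A] [Group B] :
    Nat.card (Abelianization (A × B)) =
      Nat.card (Abelianization A) * Nat.card (Abelianization B) := by
  rw [card_ab, card_ab, card_ab, ← Subgroup.index_prod]
  congr 1
  rw [commutator_def, commutator_def, commutator_def, ← Subgroup.commutator_prod_prod]
  simp

theorem wt_fst {A B : Type*} [Group A] [Group B] [Finite B] (h : IsWeaklyTop (A × B)) :
    IsWeaklyTop A := by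
  intro K
  have h1 := h (K.prod ⊤)
  rw [card_ab_congr (K.prodEquiv (⊤ : Subgroup B)), card_ab_prod, card_ab_prod,
    card_ab_congr (Subgroup.topEquiv (G := B))] at h1
  have : 0 < Nat.card (Abelianization B) := by
    rw [card_ab]
    exact Nat.pos_of_ne_zero Subgroup.FiniteIndex.index_ne_zero
  exact Nat.le_of_mul_le_mul_right h1 this

theorem wt_sylow {G : Type*} [Group G] [Finite G] [Group.IsNilpotent G] (h : IsWeaklyTop G)
    (p : ℕ) (hp : p.Prime) (P : Sylow p G) : IsWeaklyTop P := by
  have : Fact p.Prime := ⟨hp⟩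
  obtain ⟨H, hHn, hHp, hPH, hsup, hcompl, hmem⟩ := nil_decomp p P
  have e : ↥(P : Subgroup G) × H ≃* G := MulEquiv.ofBijective
    (MonoidHom.noncommCoprod (P : Subgroup G).subtype H.subtype
      fun a b => hPH a a.2 b b.2) hcompl
  exact wt_fst (wt_congr e.symm h)

theorem wt_quot {G : Type*} [Group G] [Finite G] (h : IsWeaklyTop G) (N : Subgroup G) [N.Normal]
    (hN : N ≤ commutator G) : IsWeaklyTop (G ⧸ N) := by
  intro K
  let π := QuotientGroup.mk' N
  have hπ : Function.Surjective π := QuotientGroup.mk'_surjective N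
  have h1 : Nat.card (Abelianization (G ⧸ N)) = Nat.card (Abelianization G) := by
    rw [card_ab, card_ab, ← Subgroup.index_comap_of_surjective _ hπ]
    congr 1
    rw [commutator_def, ← Subgroup.map_top_of_surjective π hπ, ← Subgroup.map_commutator,
      Subgroup.comap_map_eq, QuotientGroup.ker_mk', ← commutator_def]
    exact sup_eq_left.2 hN
  rw [h1, card_ab_sub]
  obtain ⟨J, rfl⟩ : ∃ J : Subgroup G, J.map π = K := ⟨K.comap π, Subgroup.map_comap_eq_self_of_surjective hπ K⟩
  rw [← Subgroup.map_commutator, ← Subgroup.relIndex_comap, Subgroup.comap_map_eq]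
  refine le_trans ?_ (h J)
  rw [card_ab_sub]
  exact Nat.le_of_dvd (Nat.pos_of_ne_zero Subgroup.FiniteIndex.index_ne_zero)
    (Subgroup.relIndex_dvd_of_le_left J le_sup_left)

theorem wt_supp {G : Type*} [Group G] [Finite G] (h : IsWeaklyTop G) (K : Subgroup G)
    (hK : K ⊔ commutator G = ⊤) :
    ⁅K, K⁆ = K ⊓ commutator G ∧ Nat.card (Abelianization K) = Nat.card (Abelianization G) ∧
      IsWeaklyTop K := by
  have h1 : (K ⊓ commutator G).relIndex K = (commutator G).index := by
    rw [Subgroup.inf_relIndex_left, ← Subgroup.relIndex_sup_right, hK, Subgroup.relIndex_top_right]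
  have h2 : ⁅K, K⁆ ≤ K ⊓ commutator G :=
    le_inf (Subgroup.commutator_le_self K) (Subgroup.commutator_mono le_top le_top)
  have h3 := Subgroup.relIndex_mul_relIndex _ _ K h2 inf_le_left
  have h4 := h K
  rw [card_ab_sub, card_ab, ← h3, h1] at h4
  have h5 : 0 < (commutator G).index := Nat.pos_of_ne_zero Subgroup.FiniteIndex.index_ne_zero
  have h6 : 0 < ⁅K, K⁆.relIndex (K ⊓ commutator G) :=
    Nat.pos_of_ne_zero Subgroup.FiniteIndex.index_ne_zero
  have h7 : ⁅K, K⁆.relIndex (K ⊓ commutator G) = 1 := by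
    have : ⁅K, K⁆.relIndex (K ⊓ commutator G) ≤ 1 := by
      by_contra! h8
      nlinarith
    omega
  have h8 : Nat.card (Abelianization K) = Nat.card (Abelianization G) := by
    rw [card_ab_sub, card_ab, ← h3, h1, h7, one_mul]
  refine ⟨le_antisymm h2 (Subgroup.relIndex_eq_one.1 h7), h8, ?_⟩
  intro J
  rw [h8, card_ab_congr (J.equivMapOfInjective K.subtype K.subtype_injective)]
  exact h _


theorem comm_top_ne {P : Type*} [Group P] [Group.IsNilpotent P] (Q : Subgroup P)
    (hQ : Q ≠ ⊥) : ¬ Q ≤ ⁅Q, (⊤ : Subgroup P)⁆ := by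
  intro h
  obtain ⟨n, hn⟩ := Subgroup.nilpotent_iff_lowerCentralSeries.1 ‹Group.IsNilpotent P›
  have : ∀ k, Q ≤ (⊤ : Subgroup P).lowerCentralSeries k := by
    intro k
    induction k with
    | zero => simp
    | succ k ih =>
      rw [Subgroup.lowerCentralSeries_succ]
      exact h.trans (Subgroup.commutator_mono ih le_rfl)
  exact hQ (le_bot_iff.1 (hn ▸ this n))

theorem tate_perfect {G : Type*} [Group G] [Finite G] (q : ℕ) [Fact q.Prime] (N : Subgroup G)
    [N.Normal] (hN : ⁅N, N⁆ = N) (P : Subgroup G) (hP : IsPGroup q P)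
    (hidx : (P.relIndex (N ⊔ P)).Coprime q) (hQ : P ⊓ N ≤ ⁅P, P⁆) : P ⊓ N = ⊥ := by
  have hnil : Group.IsNilpotent P := hP.isNilpotent
  let Q : Subgroup P := N.subgroupOf P
  have hQn : Q.Normal := inferInstance
  by_contra hne
  have hQb : Q ≠ ⊥ := by
    intro h
    apply hne
    rw [eq_bot_iff]
    rintro x ⟨hxP, hxN⟩
    have : (⟨x, hxP⟩ : P) ∈ Q := hxN
    rw [h] at this
    exact congrArg Subtype.val (Subgroup.mem_bot.1 this)
  let S : Subgroup P := ⁅Q, (⊤ : Subgroup P)⁆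
  have hSn : S.Normal := Subgroup.commutator_normal _ _
  have hSQ : S ≤ Q := Subgroup.commutator_le_left Q ⊤
  obtain ⟨x, hxQ, hxS⟩ : ∃ x ∈ Q, x ∉ S := by
    by_contra! h
    exact comm_top_ne Q hQb h
  let β : (P ⧸ S) →* G ⧸ N := QuotientGroup.lift S ((QuotientGroup.mk' N).comp P.subtype) (by
    intro s hs
    exact (QuotientGroup.eq_one_iff (s : G)).2 (hSQ hs))
  have hβ : ∀ y : P, β (QuotientGroup.mk y) = QuotientGroup.mk (y : G) := fun _ => rfl
  have hcen : ∀ t ∈ β.ker, ∀ s, t * s = s * t := by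
    intro t ht s
    obtain ⟨t, rfl⟩ := QuotientGroup.mk_surjective t
    obtain ⟨s, rfl⟩ := QuotientGroup.mk_surjective s
    have htQ : t ∈ Q := (QuotientGroup.eq_one_iff (t : G)).1 ht
    rw [← commutatorElement_eq_one_iff_mul_comm]
    have : ⁅t, s⁆ ∈ S := Subgroup.commutator_mem_commutator htQ (Subgroup.mem_top s)
    exact (QuotientGroup.eq_one_iff ⁅t, s⁆).2 this
  let _ : CommGroup β.ker :=
    { (inferInstance : Group β.ker) with
      mul_comm := fun a b => Subtype.ext (hcen a a.2 b) }
  let E : Subgroup (G × (P ⧸ S)) := MonoidHom.eqLocus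
    ((QuotientGroup.mk' N).comp (MonoidHom.fst G (P ⧸ S))) (β.comp (MonoidHom.snd G (P ⧸ S)))
  have hE : ∀ g t, (g, t) ∈ E ↔ (QuotientGroup.mk g : G ⧸ N) = β t := fun g t => Iff.rfl
  let f : E →* G := (MonoidHom.fst G (P ⧸ S)).comp E.subtype
  have hrange : f.range = N ⊔ P := by
    apply le_antisymm
    · rintro _ ⟨⟨⟨g, t⟩, hgt⟩, rfl⟩
      obtain ⟨t, rfl⟩ := QuotientGroup.mk_surjective t
      have h1 : (QuotientGroup.mk g : G ⧸ N) = QuotientGroup.mk (t : G) := hgt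
      have h2 : (t : G)⁻¹ * g ∈ N := QuotientGroup.eq.1 h1.symm
      show g ∈ N ⊔ P
      have h3 : g = t * ((t : G)⁻¹ * g) := by simp
      rw [h3]
      exact Subgroup.mul_mem _ (Subgroup.mem_sup_right t.2) (Subgroup.mem_sup_left h2)
    · refine sup_le (fun n hn => ?_) fun y hy => ?_
      · exact ⟨⟨(n, 1), (hE n 1).2 (by rw [map_one]; exact (QuotientGroup.eq_one_iff n).2 hn)⟩, rfl⟩
      · exact ⟨⟨(y, QuotientGroup.mk ⟨y, hy⟩), (hE _ _).2 rfl⟩, rfl⟩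
  let PE : Subgroup E := P.comap f
  have hidx' : PE.index = P.relIndex (N ⊔ P) := by rw [Subgroup.index_comap, hrange]
  have hker : ∀ e : PE, (QuotientGroup.mk (⟨f e, e.2⟩ : P) : P ⧸ S)⁻¹ * e.1.1.2 ∈ β.ker := by
    intro e
    rw [MonoidHom.mem_ker, map_mul, map_inv, hβ]
    have h1 : (QuotientGroup.mk (f e) : G ⧸ N) = β e.1.1.2 := e.1.2
    rw [← h1, inv_mul_cancel]
  let φ : PE →* β.ker := MonoidHom.mk' (fun e => ⟨_, hker e⟩) (by
    intro e e'
    apply Subtype.ext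
    have h1 := hcen _ (hker e)
    show (QuotientGroup.mk ((⟨f e, e.2⟩ : P) * ⟨f e', e'.2⟩) : P ⧸ S)⁻¹ * (e.1.1.2 * e'.1.1.2) =
      ((QuotientGroup.mk (⟨f e, e.2⟩ : P) : P ⧸ S)⁻¹ * e.1.1.2) *
      ((QuotientGroup.mk (⟨f e', e'.2⟩ : P) : P ⧸ S)⁻¹ * e'.1.1.2)
    rw [QuotientGroup.mk_mul, mul_inv_rev, ← mul_assoc (_⁻¹ * e.1.1.2), h1]
    simp only [mul_assoc])
  let τ : E →* β.ker := φ.transfer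
  have hxker : (QuotientGroup.mk x : P ⧸ S) ∈ β.ker := by
    rw [MonoidHom.mem_ker, hβ]
    exact (QuotientGroup.eq_one_iff (x : G)).2 hxQ
  -- three elements
  let e1 : E := ⟨(1, QuotientGroup.mk x), (hE _ _).2 (by
    rw [MonoidHom.mem_ker.1 hxker]; rfl)⟩
  let ιN : N →* E := MonoidHom.mk' (fun n => ⟨((n : G), 1), (hE _ _).2 (by
    rw [map_one]; exact (QuotientGroup.eq_one_iff (n : G)).2 n.2)⟩) (by
      intro a b
      apply Subtype.ext
      simp)
  let ιP : P →* E := MonoidHom.mk' (fun y => ⟨((y : G), QuotientGroup.mk y), (hE _ _).2 rfl⟩) (by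
      intro a b
      apply Subtype.ext
      simp)
  have hτN : ∀ n, τ (ιN n) = 1 := by
    intro n
    have h1 : commutator N ≤ (τ.comp ιN).ker := Abelianization.commutator_subset_ker _
    have h2 : n ∈ commutator N := by
      have h3 : (n : G) ∈ (commutator N).map N.subtype := by
        rw [Subgroup.map_subtype_commutator, hN]; exact n.2
      obtain ⟨m, hm, hmn⟩ := h3
      rwa [← Subtype.ext hmn]
    exact h1 h2
  have hτP : τ (ιP x) = 1 := by
    have h1 : commutator P ≤ (τ.comp ιP).ker := Abelianization.commutator_subset_ker _
    have h2 : x ∈ commutator P := by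
      have h3 : (x : G) ∈ (commutator P).map P.subtype := by
        rw [Subgroup.map_subtype_commutator]; exact hQ ⟨x.2, hxQ⟩
      obtain ⟨m, hm, hmn⟩ := h3
      rwa [← Subtype.ext hmn]
    exact h1 h2
  have hprod : ιP x = ιN ⟨x, hxQ⟩ * e1 := by
    apply Subtype.ext
    show ((x : G), (QuotientGroup.mk x : P ⧸ S)) = ((x : G) * 1, 1 * (QuotientGroup.mk x : P ⧸ S))
    rw [mul_one, one_mul]
  have hτe : τ e1 = 1 := by
    rw [hprod, map_mul, hτN, one_mul] at hτP
    exact hτP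
  have hcen1 : ∀ k : ℕ, ∀ g : E, g⁻¹ * e1 ^ k * g = e1 ^ k := by
    intro k g
    have h1 : Commute e1 g := by
      apply Subtype.ext
      refine Prod.ext ?_ (hcen _ hxker _)
      show (1 : G) * g.1.1 = g.1.1 * 1
      simp
    rw [mul_assoc, (h1.pow_left k).eq, inv_mul_cancel_left]
  have hpow := MonoidHom.transfer_eq_pow φ e1 (fun k g _ => hcen1 k g)
  have hpow2 : φ.transfer e1 = 1 := hτe
  rw [hpow2] at hpow
  have hpow3 := congrArg Subtype.val hpow
  have h4 : ∀ (k : ℕ) (hk : e1 ^ k ∈ PE), ((φ ⟨e1 ^ k, hk⟩ : β.ker) : P ⧸ S)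
      = (QuotientGroup.mk x : P ⧸ S) ^ k := by
    intro k hk
    have h5 : (⟨f (e1 ^ k), hk⟩ : P) = 1 := by
      apply Subtype.ext
      show f (e1 ^ k) = 1
      rw [map_pow]
      show (1 : G) ^ k = 1
      simp
    show (QuotientGroup.mk (⟨f (e1 ^ k), hk⟩ : P) : P ⧸ S)⁻¹ * (e1 ^ k).1.2 = _
    rw [h5, QuotientGroup.mk_one, inv_one, one_mul]
    rfl
  rw [h4] at hpow3
  apply hxS
  have h6 : x ^ PE.index ∈ S := (QuotientGroup.eq_one_iff _).1 hpow3.symm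
  rw [hidx'] at h6
  obtain ⟨k, hk⟩ := hP x
  have h7 : (P.relIndex (N ⊔ P)).Coprime (q ^ k) := Nat.Coprime.pow_right k hidx
  have h8 : x ^ (Nat.gcd (P.relIndex (N ⊔ P)) (q ^ k)) ∈ S := by
    have hzx : x ^ ((Nat.gcd (P.relIndex (N ⊔ P)) (q ^ k) : ℕ) : ℤ) ∈ S := by
      rw [Nat.gcd_eq_gcd_ab, zpow_add, zpow_mul, zpow_mul, zpow_natCast, zpow_natCast, hk, one_zpow,
        mul_one]
      exact S.zpow_mem h6 _
    rwa [zpow_natCast] at hzx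
  rwa [h7, pow_one] at h8


theorem nil_comm_inter {X : Type*} [Group X] [Finite X] [Group.IsNilpotent X] (p : ℕ)
    [Fact p.Prime] (P : Sylow p X) : (P : Subgroup X) ⊓ commutator X ≤ ⁅(P : Subgroup X), (P : Subgroup X)⁆ := by
  obtain ⟨H, hHn, hHp, hPH, hsup, hcompl, hmem⟩ := nil_decomp p P
  have hle : commutator X ≤ ⁅(P : Subgroup X), (P : Subgroup X)⁆ ⊔ ⁅H, H⁆ := by
    rw [commutator_def, Subgroup.commutator_le]
    intro g _ k _
    have hg : g ∈ (P : Subgroup X) ⊔ H := hsup ▸ Subgroup.mem_top g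
    have hk : k ∈ (P : Subgroup X) ⊔ H := hsup ▸ Subgroup.mem_top k
    obtain ⟨a, ha, b, hb, rfl⟩ := Subgroup.mem_sup_of_normal_right.1 hg
    obtain ⟨c, hc, d, hd, rfl⟩ := Subgroup.mem_sup_of_normal_right.1 hk
    have h1 : ⁅a * b, c * d⁆ = ⁅a, c⁆ * ⁅b, d⁆ := by
      have e1 := hPH a ha b hb
      have e3 : Commute b c := (hPH c hc b hb).symm
      have e5 : Commute (a⁻¹) (b⁻¹ ) := (show Commute a b from hPH a ha b hb).inv_inv
      have e6 : Commute (c⁻¹) (b * d * b⁻¹) := by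
        have : Commute c (b * d * b⁻¹) :=
          hPH c hc _ (H.mul_mem (H.mul_mem hb hd) (H.inv_mem hb))
        exact this.inv_left
      have e7 : Commute a⁻¹ (b * d * b⁻¹) := by
        have : Commute a (b * d * b⁻¹) :=
          hPH a ha _ (H.mul_mem (H.mul_mem hb hd) (H.inv_mem hb))
        exact this.inv_left
      have e8 : Commute d⁻¹ c⁻¹ := (show Commute c d from hPH c hc d hd).symm.inv_inv
      simp only [commutatorElement_def, mul_inv_rev]
      calc a * b * (c * d) * (b⁻¹ * a⁻¹) * (d⁻¹ * c⁻¹)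
          = a * (b * c) * d * b⁻¹ * a⁻¹ * (d⁻¹ * c⁻¹) := by group
        _ = a * c * ((b * d * b⁻¹) * a⁻¹) * (d⁻¹ * c⁻¹) := by rw [e3.eq]; group
        _ = a * c * (a⁻¹ * (b * d * b⁻¹)) * (c⁻¹ * d⁻¹) := by rw [e7.eq, e8.eq]
        _ = a * c * a⁻¹ * ((b * d * b⁻¹) * c⁻¹) * d⁻¹ := by group
        _ = a * c * a⁻¹ * (c⁻¹ * (b * d * b⁻¹)) * d⁻¹ := by rw [e6.eq]
        _ = _ := by group
    rw [h1]
    exact Subgroup.mul_mem _ (Subgroup.mem_sup_left (Subgroup.commutator_mem_commutator ha hc))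
      (Subgroup.mem_sup_right (Subgroup.commutator_mem_commutator hb hd))
  rintro x ⟨hxP, hxc⟩
  have hHH : ⁅H, H⁆.Normal := Subgroup.commutator_normal H H
  obtain ⟨a, ha, b, hb, rfl⟩ := Subgroup.mem_sup_of_normal_right.1 (hle hxc)
  have haP : a ∈ (P : Subgroup X) := Subgroup.commutator_le_self _ ha
  have hbH : b ∈ H := Subgroup.commutator_le_self _ hb
  have hbP : b ∈ (P : Subgroup X) := by
    have := (P : Subgroup X).mul_mem ((P : Subgroup X).inv_mem haP) hxP
    rwa [inv_mul_cancel_left] at this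
  have : b ∈ (P : Subgroup X) ⊓ H := ⟨hbP, hbH⟩
  rw [hcompl.disjoint.eq_bot, Subgroup.mem_bot] at this
  rwa [this, mul_one]

theorem nonab_case {G : Type u} [Group G] [Finite G] (h : IsWeaklyTop G)
    (ih : ∀ K : Subgroup G, K ≠ ⊤ → IsWeaklyTop K → Group.IsNilpotent K) (N : Subgroup G)
    [N.Normal] (hNb : N ≠ ⊥) (hmin : ∀ M : Subgroup G, M.Normal → M ≤ N → M = ⊥ ∨ M = N)
    (hNG : N ≤ commutator G) : ∀ a ∈ N, ∀ b ∈ N, a * b = b * a := by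
  rcases hmin ⁅N, N⁆ (Subgroup.commutator_normal N N) (Subgroup.commutator_le_self N) with hc | hc
  · intro a ha b hb
    have : ⁅a, b⁆ ∈ ⁅N, N⁆ := Subgroup.commutator_mem_commutator ha hb
    rw [hc, Subgroup.mem_bot] at this
    exact commutatorElement_eq_one_iff_mul_comm.1 this
  exfalso
  have hNnt : Nontrivial N := (Subgroup.nontrivial_iff_ne_bot N).2 hNb
  have hcard : Nat.card N ≠ 1 := (Finite.one_lt_card_iff_nontrivial.2 hNnt).ne'
  obtain ⟨q, hq, hqN⟩ := Nat.exists_prime_and_dvd hcard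
  have : Fact q.Prime := ⟨hq⟩
  obtain ⟨Q⟩ : Nonempty (Sylow q N) := inferInstance
  set Q' : Subgroup G := (Q : Subgroup N).map N.subtype with hQ'
  have hfr := Sylow.normalizer_sup_eq_top Q
  rw [← hQ'] at hfr
  have hQb : Q' ≠ ⊥ := by
    intro hb
    have h1 : Nat.card Q' = Nat.card (Q : Subgroup N) :=
      Nat.card_congr ((Q : Subgroup N).equivMapOfInjective N.subtype N.subtype_injective).toEquiv.symm
    rw [hb, Subgroup.card_bot] at h1
    have h2 := Q.dvd_card_of_dvd_card hqN
    rw [← h1] at h2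
    exact hq.one_lt.ne' (Nat.dvd_one.1 h2)
  have hQp : ∀ x ∈ Q', ∃ k : ℕ, x ^ q ^ k = 1 := by
    rintro _ ⟨x, hx, rfl⟩
    obtain ⟨k, hk⟩ := Q.isPGroup' ⟨x, hx⟩
    exact ⟨k, congrArg (fun t : (Q : Subgroup N) => ((t : N) : G)) hk⟩
  obtain ⟨K, hKdef⟩ : ∃ K : Subgroup G, K = Subgroup.normalizer (Q' : Set G) := ⟨_, rfl⟩
  rw [← hKdef] at hfr
  have hKt : K ≠ ⊤ := by
    intro ht
    have hQn : Q'.Normal := Subgroup.normalizer_eq_top_iff.1 (hKdef ▸ ht)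
    rcases hmin Q' hQn (Subgroup.map_subtype_le _) with h1 | h1
    · exact hQb h1
    · have hpN : IsPGroup q N := by
        intro x
        have hx : (x : G) ∈ Q' := by rw [h1]; exact x.2
        obtain ⟨k, hk⟩ := hQp x hx
        exact ⟨k, Subtype.ext hk⟩
      have hnil : Group.IsNilpotent N := hpN.isNilpotent
      have hlt := Group.IsSolvable.commutator_lt_top_of_nontrivial N
      apply hlt.ne
      rw [eq_top_iff]
      intro n _
      have h3 : (n : G) ∈ (commutator N).map N.subtype := by
        rw [Subgroup.map_subtype_commutator, hc]; exact n.2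
      obtain ⟨m, hm, hmn⟩ := h3
      rwa [← Subtype.ext hmn]
  have hKG : K ⊔ commutator G = ⊤ := top_le_iff.1 (hfr ▸ sup_le_sup_left hNG K)
  obtain ⟨hKc, -, hKw⟩ := wt_supp h K hKG
  have hKnil : Group.IsNilpotent K := ih K hKt hKw
  obtain ⟨P⟩ : Nonempty (Sylow q K) := inferInstance
  obtain ⟨-, -, -, -, -, -, hmem⟩ := nil_decomp q P
  set P' : Subgroup G := (P : Subgroup K).map K.subtype with hP'
  have hQK : Q' ≤ K := hKdef ▸ Subgroup.le_normalizer
  have hQP : Q' ≤ P' := by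
    intro x hx
    obtain ⟨k, hk⟩ := hQp x hx
    exact ⟨⟨x, hQK hx⟩, hmem _ ⟨k, Subtype.ext hk⟩, rfl⟩
  have hP'p : IsPGroup q P' := by
    rintro ⟨_, x, hx, rfl⟩
    obtain ⟨k, hk⟩ := P.isPGroup' ⟨x, hx⟩
    exact ⟨k, Subtype.ext (congrArg (fun t : (P : Subgroup K) => ((t : K) : G)) hk)⟩
  have hidx : (P'.relIndex (N ⊔ P')).Coprime q := by
    have h1 : P'.relIndex (N ⊔ P') = P'.relIndex N := by
      have e1 := Subgroup.relIndex_mul_relIndex (P' ⊓ N) N (N ⊔ P') inf_le_right le_sup_left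
      have e2 := Subgroup.relIndex_mul_relIndex (P' ⊓ N) P' (N ⊔ P') inf_le_left le_sup_right
      rw [Subgroup.relIndex_sup_left, Subgroup.inf_relIndex_right] at e1
      rw [Subgroup.inf_relIndex_left, ← e1, mul_comm] at e2
      exact Nat.eq_of_mul_eq_mul_right
        (Nat.pos_of_ne_zero Subgroup.FiniteIndex.index_ne_zero) e2
    rw [h1]
    have h2 : P'.relIndex N ∣ Q'.relIndex N := Subgroup.relIndex_dvd_of_le_left N hQP
    have h3 : Q'.relIndex N = (Q : Subgroup N).index := by
      rw [Subgroup.relIndex]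
      congr 1
      exact Subgroup.comap_map_eq_self_of_injective N.subtype_injective _
    rw [h3] at h2
    exact (((Nat.Prime.coprime_iff_not_dvd hq).2 Q.not_dvd_index).coprime_dvd_right h2).symm
  have hPN : P' ⊓ N ≤ ⁅P', P'⁆ := by
    rintro _ ⟨⟨x, hx, rfl⟩, hxN⟩
    have h1 : (x : G) ∈ ⁅K, K⁆ := hKc ▸ ⟨x.2, hNG hxN⟩
    have h2 : x ∈ commutator K := by
      rw [← Subgroup.map_subtype_commutator] at h1
      obtain ⟨m, hm, hmn⟩ := h1
      rwa [← Subtype.ext hmn]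
    have h3 := nil_comm_inter q P ⟨hx, h2⟩
    rw [hP', ← Subgroup.map_commutator]
    exact ⟨x, h3, rfl⟩
  have hbot := tate_perfect q N hc P' hP'p hidx hPN
  exact hQb (le_bot_iff.1 (hbot ▸ le_inf hQP (Subgroup.map_subtype_le _)))


theorem exists_conjRep {G : Type u} [Group G] [Finite G] (H N : Subgroup G) [N.Normal]
    (hc : ∀ a ∈ N, ∀ b ∈ N, a * b = b * a) :
    ∃ (V : Type u) (_ : AddCommGroup V) (_ : Finite V) (e : V ≃ N) (ρ : Representation ℤ H V),
      ∀ (h : H) (v : V), ((e (ρ h v) : N) : G) = h * (e v : N) * (h : G)⁻¹ := by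
  let _ : CommGroup N :=
    { (inferInstance : Group N) with
      mul_comm := fun a b => Subtype.ext (hc a a.2 b b.2) }
  refine ⟨Additive N, inferInstance, inferInstanceAs (Finite N), Additive.toMul,
    { toFun := fun h => (MonoidHom.toAdditive
        ((MulAut.conjNormal (h : G) : MulAut N).toMonoidHom)).toIntLinearMap
      map_one' := ?_
      map_mul' := ?_ }, ?_⟩
  · ext v
    simp
  · intro a b
    ext v
    simp
  · intro h v
    exact MulAut.conjNormal_apply (H := N) (h : G) (Additive.toMul v)

theorem triv_action {G : Type u} [Group G] [Finite G] (H N Q : Subgroup G) [N.Normal]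
    (hmin : ∀ M : Subgroup G, M.Normal → M ≤ N → M = ⊥ ∨ M = N)
    (hc : ∀ a ∈ N, ∀ b ∈ N, a * b = b * a) (hHN : H ⊔ N = ⊤)
    (q : ℕ) [Fact q.Prime] (hqN : q ∣ Nat.card N) (hQ : IsPGroup q Q)
    (hQH : ∀ h ∈ H, ∀ x ∈ Q, h * x * h⁻¹ ∈ Q) :
    ∀ x ∈ Q, ∀ n ∈ N, x * n = n * x := by
  have hconj : ∀ h ∈ H, ∀ a ∈ N ⊓ Subgroup.centralizer (Q : Set G),
      h * a * h⁻¹ ∈ N ⊓ Subgroup.centralizer (Q : Set G) := by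
    intro h hh a ha
    refine ⟨(inferInstance : N.Normal).conj_mem a ha.1 h, ?_⟩
    refine Subgroup.mem_centralizer_iff.2 ?_
    intro x hx
    have h1 := hQH h⁻¹ (H.inv_mem hh) x hx
    have h2 := Subgroup.mem_centralizer_iff.1 ha.2 _ h1
    have h3 : h * (h⁻¹ * x * h⁻¹⁻¹ * a) * h⁻¹ = h * (a * (h⁻¹ * x * h⁻¹⁻¹)) * h⁻¹ := by rw [h2]
    calc x * (h * a * h⁻¹) = h * (h⁻¹ * x * h⁻¹⁻¹ * a) * h⁻¹ := by group
      _ = h * (a * (h⁻¹ * x * h⁻¹⁻¹)) * h⁻¹ := h3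
      _ = h * a * h⁻¹ * x := by group
  have hn : (N ⊓ Subgroup.centralizer (Q : Set G)).Normal := by
    refine ⟨fun a ha g => ?_⟩
    have hg : g ∈ H ⊔ N := hHN ▸ Subgroup.mem_top g
    obtain ⟨h, hh, n, hn, rfl⟩ := Subgroup.mem_sup_of_normal_right.1 hg
    have : h * n * a * (h * n)⁻¹ = h * a * h⁻¹ := by
      have := hc n hn a ha.1
      calc h * n * a * (h * n)⁻¹ = h * (n * a) * n⁻¹ * h⁻¹ := by group
        _ = h * (a * n) * n⁻¹ * h⁻¹ := by rw [this]
        _ = _ := by group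
    rw [this]
    exact hconj h hh a ha
  have hne : N ⊓ Subgroup.centralizer (Q : Set G) ≠ ⊥ := by
    let _ : MulAction Q N :=
      { smul := fun x n => ⟨x * n * (x : G)⁻¹, (inferInstance : N.Normal).conj_mem n n.2 x⟩
        one_smul := fun n => Subtype.ext (by
          show ((1 : Q) : G) * n * ((1 : Q) : G)⁻¹ = n
          simp)
        mul_smul := fun a b n => Subtype.ext (by
          show ((a * b : Q) : G) * n * ((a * b : Q) : G)⁻¹ = a * (b * n * (b : G)⁻¹) * (a : G)⁻¹
          simp [mul_assoc]) }
    have hsm : ∀ (x : Q) (n : N), ((x • n : N) : G) = x * n * (x : G)⁻¹ := fun _ _ => rfl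
    obtain ⟨b, hb, hb1⟩ := hQ.exists_fixed_point_of_prime_dvd_card_of_fixed_point N hqN
      (a := (1 : N)) (fun x => Subtype.ext (by rw [hsm]; simp))
    intro hbot
    apply hb1
    have : (b : G) ∈ N ⊓ Subgroup.centralizer (Q : Set G) := by
      refine ⟨b.2, ?_⟩
      refine Subgroup.mem_centralizer_iff.2 ?_
      intro x hx
      have h1 := congrArg Subtype.val (hb ⟨x, hx⟩)
      rw [hsm] at h1
      exact mul_inv_eq_iff_eq_mul.1 h1
    rw [hbot, Subgroup.mem_bot] at this
    exact Subtype.ext this.symm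
  have heq := (hmin _ hn inf_le_left).resolve_left hne
  intro x hx n hnN
  rw [← heq] at hnN
  exact Subgroup.mem_centralizer_iff.1 hnN.2 x hx

theorem min_exponent {G : Type u} [Group G] [Finite G] (N : Subgroup G) [N.Normal]
    (hmin : ∀ M : Subgroup G, M.Normal → M ≤ N → M = ⊥ ∨ M = N)
    (hc : ∀ a ∈ N, ∀ b ∈ N, a * b = b * a)
    (q : ℕ) [Fact q.Prime] (hqN : q ∣ Nat.card N) : IsPGroup q N := by
  let M : Subgroup G :=
    { carrier := {a | a ∈ N ∧ a ^ q = 1}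
      one_mem' := ⟨N.one_mem, one_pow _⟩
      mul_mem' := fun {a b} ha hb => ⟨N.mul_mem ha.1 hb.1, by
        rw [(show Commute a b from hc a ha.1 b hb.1).mul_pow, ha.2, hb.2, one_mul]⟩
      inv_mem' := fun {a} ha => ⟨N.inv_mem ha.1, by
        rw [inv_pow, ha.2, inv_one]⟩ }
  have hM : M.Normal := ⟨fun a ha g => ⟨(inferInstance : N.Normal).conj_mem a ha.1 g, by
    rw [conj_pow, ha.2, mul_one, mul_inv_cancel]⟩⟩
  have hne : M ≠ ⊥ := by
    obtain ⟨x, hx⟩ := exists_prime_orderOf_dvd_card' q hqN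
    intro hb
    have : (x : G) ∈ M := ⟨x.2, by
      rw [← hx]; exact congrArg Subtype.val (pow_orderOf_eq_one x)⟩
    rw [hb, Subgroup.mem_bot] at this
    have h1 : x = 1 := Subtype.ext this
    rw [h1, orderOf_one] at hx
    exact (Fact.out : q.Prime).one_lt.ne hx
  have heq := (hmin M hM (fun a ha => ha.1)).resolve_left hne
  intro x
  refine ⟨1, Subtype.ext ?_⟩
  have : (x : G) ∈ M := by rw [heq]; exact x.2
  simpa using this.2


theorem ab_case {G : Type u} [Group G] [Finite G] (hG : IsWeaklyTop G) (H N : Subgroup G)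
    [N.Normal] (hNb : N ≠ ⊥)
    (hmin : ∀ M : Subgroup G, M.Normal → M ≤ N → M = ⊥ ∨ M = N)
    (hc : ∀ a ∈ N, ∀ b ∈ N, a * b = b * a) (hNG : N ≤ commutator G)
    (hHnil : Group.IsNilpotent H) (hHN : H ⊓ N = ⊥) (hHN' : H ⊔ N = ⊤) : False := by
  have hN1 : 1 < Nat.card N := (Subgroup.one_lt_card_iff_ne_bot N).2 hNb
  obtain ⟨q, hq, hqN⟩ := Nat.exists_prime_and_dvd hN1.ne'
  have : Fact q.Prime := ⟨hq⟩
  have hNp : IsPGroup q N := min_exponent N hmin hc q hqN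
  obtain ⟨k, hk⟩ := IsPGroup.iff_card.1 hNp
  obtain ⟨V, _, _, e, ρ, hρ⟩ := exists_conjRep H N hc
  have hcard : Nat.card V = Nat.card N := Nat.card_congr e
  have hρ1 : ∀ x : H, ρ x = 1 ↔ ∀ n ∈ N, (x : G) * n = n * x := by
    intro x
    rw [rep_one_iff]
    constructor
    · intro h n hn
      have h1 := hρ x (e.symm ⟨n, hn⟩)
      rw [h, Equiv.apply_symm_apply] at h1
      exact (mul_inv_eq_iff_eq_mul.1 h1.symm)
    · intro h v
      apply e.injective
      apply Subtype.ext
      rw [hρ, h _ (e v).2, mul_inv_cancel_right]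
  -- the Sylow `q`-subgroup of `H` acts trivially
  let Q : Sylow q H := default
  obtain ⟨_, _, _, _, _, _, hQmem⟩ := nil_decomp q Q
  have hQn : (Q : Subgroup H).Normal := by
    exact ((Group.isNilpotent_of_finite_tfae (G := H)).out 0 3 rfl rfl).1 hHnil q ‹_› Q
  have hco : CoAct ρ := by
    intro x
    refine ⟨ordCompl[q] (Nat.card H), ?_, ?_⟩
    · rw [hcard, hk]
      exact ((Nat.coprime_ordCompl hq Nat.card_pos.ne').symm).pow_right k
    · have hmem : x ^ (ordCompl[q] (Nat.card H)) ∈ Q := by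
        apply hQmem
        refine ⟨(Nat.card H).factorization q, ?_⟩
        rw [← pow_mul, mul_comm, Nat.ordProj_mul_ordCompl_eq_self, pow_card_eq_one']
      rw [hρ1]
      apply triv_action H N ((Q : Subgroup H).map H.subtype) hmin hc hHN' q hqN
        (Q.isPGroup'.map _)
      · rintro h hh _ ⟨y, hy, rfl⟩
        exact ⟨⟨h, hh⟩ * y * ⟨h, hh⟩⁻¹, hQn.conj_mem y hy _, rfl⟩
      · exact ⟨_, hmem, rfl⟩
  obtain ⟨K, hK⟩ : ∃ K : Subgroup H, ∀ x, x ∈ K ↔ ρ x = 1 :=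
    ⟨ρ.ker, fun x => MonoidHom.mem_ker⟩
  have hKn : K.Normal := by
    refine ⟨fun a ha g => ?_⟩
    rw [hK] at ha ⊢
    rw [map_mul, map_mul, ha, mul_one, ← map_mul, mul_inv_cancel, map_one]
  have hlt : (commutator H ⊔ K).index < Nat.card N := by
    have h1 := (theoremC.{u, u} (Nat.card N) H V ρ hcard hN1 hco (commutator H ⊔ K) ⊤
      ⟨le_top, fun r _ x => Subgroup.mem_sup_left
        (Subgroup.commutator_mem_commutator (Subgroup.mem_top _) (Subgroup.mem_top _))⟩
      (fun r _ hr => Subgroup.mem_sup_right ((hK r).2 hr))).1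
    rwa [Subgroup.relIndex_top_right] at h1
  have hKK : ⁅K, K⁆ ≤ commutator H := Subgroup.commutator_mono le_top le_top
  have hidx : (commutator H).index ≤ ⁅K, K⁆.relIndex K * (commutator H ⊔ K).index := by
    rw [← Subgroup.relIndex_mul_index (le_sup_left : commutator H ≤ commutator H ⊔ K)]
    apply Nat.mul_le_mul_right
    rw [Subgroup.relIndex_sup_left]
    refine Nat.le_of_dvd (Nat.pos_of_ne_zero ?_) (Subgroup.relIndex_dvd_of_le_left K hKK)
    exact Subgroup.FiniteIndex.index_ne_zero
  obtain ⟨C, hC⟩ : ∃ C, C = K.map H.subtype := ⟨_, rfl⟩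
  have hCH : C ≤ H := by rw [hC]; exact Subgroup.map_subtype_le K
  have hCK : ⁅C, C⁆.relIndex C = ⁅K, K⁆.relIndex K := by
    rw [hC, ← Subgroup.map_commutator]
    exact Subgroup.relIndex_map_map_of_injective _ _ H.subtype_injective
  have hCN : ∀ c ∈ C, ∀ n ∈ N, c * n = n * c := by
    rw [hC]
    rintro _ ⟨x, hx, rfl⟩ n hn
    exact (hρ1 x).1 ((hK x).1 hx) n hn
  have hcomm : ⁅C ⊔ N, C ⊔ N⁆ ≤ ⁅C, C⁆ := by
    rw [Subgroup.commutator_le]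
    intro g hg k hk
    obtain ⟨a, ha, b, hb, rfl⟩ := Subgroup.mem_sup_of_normal_right.1 hg
    obtain ⟨c, hc', d, hd, rfl⟩ := Subgroup.mem_sup_of_normal_right.1 hk
    have h1 : ⁅a * b, c * d⁆ = ⁅a, c⁆ := by
      have e1 : Commute b c := (hCN c hc' b hb).symm
      have e2 : Commute b d := hc b hb d hd
      have e3 : Commute b (c * d) := e1.mul_right e2
      have e4 : Commute d a := (hCN a ha d hd).symm
      have e5 : a * b * (c * d) = a * (c * d) * b := by
        rw [mul_assoc, e3.eq, ← mul_assoc]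
      have e6 : d * a⁻¹ = a⁻¹ * d := e4.inv_right.eq
      rw [commutatorElement_def, commutatorElement_def, e5, mul_inv_rev, mul_inv_rev]
      calc a * (c * d) * b * (b⁻¹ * a⁻¹) * (d⁻¹ * c⁻¹)
          = a * c * (d * a⁻¹) * d⁻¹ * c⁻¹ := by group
        _ = a * c * (a⁻¹ * d) * d⁻¹ * c⁻¹ := by rw [e6]
        _ = _ := by group
    rw [h1]
    exact Subgroup.commutator_mem_commutator ha hc'
  have hbig : ⁅C, C⁆.relIndex (C ⊔ N) = ⁅C, C⁆.relIndex C * Nat.card N := by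
    rw [← Subgroup.relIndex_mul_relIndex ⁅C, C⁆ C (C ⊔ N) (Subgroup.commutator_le_self C)
      le_sup_left]
    congr 1
    have h1 := Subgroup.relIndex_mul_relIndex ⊥ C (C ⊔ N) bot_le le_sup_left
    have h2 := Subgroup.relIndex_mul_relIndex ⊥ N (C ⊔ N) bot_le le_sup_right
    have h3 : N.relIndex C = Nat.card C := by
      rw [← Subgroup.inf_relIndex_right, ← Subgroup.relIndex_bot_left]
      congr 1
      rw [eq_bot_iff, ← hHN]
      exact fun x hx => ⟨hCH hx.2, hx.1⟩
    rw [sup_comm C N, Subgroup.relIndex_sup_left, h3, sup_comm N C,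
      Subgroup.relIndex_bot_left, ← h1, Subgroup.relIndex_bot_left, mul_comm] at h2
    exact (Nat.eq_of_mul_eq_mul_left Nat.card_pos h2).symm
  have hle := hG (C ⊔ N)
  rw [card_ab_sub] at hle
  have hsupp := (wt_supp hG H (by
    rw [eq_top_iff, ← hHN']; exact sup_le_sup_left hNG H)).2.1
  rw [← hsupp, card_ab] at hle
  have hge : ⁅C, C⁆.relIndex (C ⊔ N) ≤ ⁅C ⊔ N, C ⊔ N⁆.relIndex (C ⊔ N) := by
    refine Nat.le_of_dvd (Nat.pos_of_ne_zero ?_) (Subgroup.relIndex_dvd_of_le_left _ hcomm)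
    exact Subgroup.FiniteIndex.index_ne_zero
  rw [hbig, hCK] at hge
  have hpos : 0 < ⁅K, K⁆.relIndex K :=
    Nat.pos_of_ne_zero Subgroup.FiniteIndex.index_ne_zero
  exact absurd (hge.trans (hle.trans hidx)) (not_le.2 (Nat.mul_lt_mul_of_pos_left hlt hpos))


theorem wt_nilpotent (n : ℕ) : ∀ (G : Type u) [Group G] [Finite G], Nat.card G = n →
    IsWeaklyTop G → Group.IsNilpotent G := by
  induction n using Nat.strong_induction_on with
  | _ n IH =>
  intro G _ _ hn hG
  by_cases hab : commutator G = ⊥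
  · have hcen : ∀ a b : G, a * b = b * a := by
      intro a b
      have h1 : ⁅a, b⁆ ∈ commutator G :=
        Subgroup.commutator_mem_commutator (Subgroup.mem_top _) (Subgroup.mem_top _)
      rw [hab, Subgroup.mem_bot] at h1
      exact commutatorElement_eq_one_iff_mul_comm.1 h1
    let _ : CommGroup G := { (inferInstance : Group G) with mul_comm := hcen }
    exact CommGroup.isNilpotent
  obtain ⟨N, hNmin⟩ := Set.Finite.exists_minimal
    (s := {M : Subgroup G | M.Normal ∧ M ≠ ⊥ ∧ M ≤ commutator G}) (Set.toFinite _)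
    ⟨commutator G, inferInstance, hab, le_rfl⟩
  obtain ⟨hNn, hNb, hNG⟩ := hNmin.1
  have hmin : ∀ M : Subgroup G, M.Normal → M ≤ N → M = ⊥ ∨ M = N := by
    intro M hM hMN
    by_cases hMb : M = ⊥
    · exact Or.inl hMb
    · exact Or.inr (le_antisymm hMN (hNmin.2 ⟨hM, hMb, hMN.trans hNG⟩ hMN))
  have ih : ∀ K : Subgroup G, K ≠ ⊤ → IsWeaklyTop K → Group.IsNilpotent K := by
    intro K hK hw
    refine IH (Nat.card K) ?_ K rfl hw
    rw [← hn]
    refine lt_of_le_of_ne (Subgroup.card_le_card_group K) fun h => hK ?_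
    exact Subgroup.eq_top_of_card_eq K h
  have hc := nonab_case hG ih N hNb hmin hNG
  have hquot : Group.IsNilpotent (G ⧸ N) := by
    refine IH (Nat.card (G ⧸ N)) ?_ (G ⧸ N) rfl (wt_quot hG N hNG)
    rw [← hn, Subgroup.card_eq_card_quotient_mul_card_subgroup N]
    exact lt_mul_of_one_lt_right Nat.card_pos ((Subgroup.one_lt_card_iff_ne_bot N).2 hNb)
  rw [(Group.isNilpotent_of_finite_tfae (G := G)).out 0 3 rfl rfl]
  intro p hp P
  by_contra hP
  have hPN : ((P : Subgroup G) ⊔ N).Normal := by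
    have h1 := ((Group.isNilpotent_of_finite_tfae (G := G ⧸ N)).out 0 3 rfl rfl).1 hquot p hp
      (P.mapSurjective (QuotientGroup.mk'_surjective N))
    rw [Sylow.coe_mapSurjective] at h1
    have h2 := h1.comap (QuotientGroup.mk' N)
    rwa [Subgroup.comap_map_eq, QuotientGroup.ker_mk'] at h2
  obtain ⟨Hs, hHs⟩ : ∃ Hs, Hs = Subgroup.normalizer ((P : Subgroup G) : Set G) := ⟨_, rfl⟩
  have hfr : Hs ⊔ N = ⊤ := by
    have h1 := Sylow.normalizer_sup_eq_top' P (le_sup_left : (P : Subgroup G) ≤ (P : Subgroup G) ⊔ N)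
    have h2 : (P : Subgroup G) ≤ Hs := by rw [hHs]; exact Subgroup.le_normalizer
    rw [eq_top_iff, ← h1]
    refine sup_le ?_ (sup_le_sup_right h2 N)
    rw [hHs]
    exact le_sup_left
  have hne : Hs ≠ ⊤ := by
    rw [hHs]
    intro h
    exact hP (Subgroup.normalizer_eq_top_iff.1 h)
  have hHsw := (wt_supp hG Hs (by
    rw [eq_top_iff, ← hfr]; exact sup_le_sup_left hNG Hs)).2.2
  have hbot : Hs ⊓ N = ⊥ := by
    have hnorm : (Hs ⊓ N).Normal := by
      refine ⟨fun a ha g => ?_⟩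
      have hg : g ∈ Hs ⊔ N := hfr ▸ Subgroup.mem_top g
      obtain ⟨h, hh, m, hm, rfl⟩ := Subgroup.mem_sup_of_normal_right.1 hg
      have h1 : h * m * a * (h * m)⁻¹ = h * a * h⁻¹ := by
        calc h * m * a * (h * m)⁻¹ = h * (m * a) * m⁻¹ * h⁻¹ := by group
          _ = h * (a * m) * m⁻¹ * h⁻¹ := by rw [hc m hm a ha.2]
          _ = _ := by group
      rw [h1]
      exact ⟨Hs.mul_mem (Hs.mul_mem hh ha.1) (Hs.inv_mem hh), hNn.conj_mem a ha.2 h⟩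
    refine (hmin _ hnorm inf_le_right).resolve_right fun h => hne ?_
    rw [← hfr]
    exact (sup_eq_left.2 (inf_eq_right.1 h)).symm
  exact ab_case hG Hs N hNb hmin hc hNG (ih Hs hne hHsw) hbot hfr


/-- Every finite weakly-top group is nilpotent, hence isomorphic to the direct
product of its Sylow subgroups, each of which is weakly-top. -/
theorem weakly_top_nilpotent (G : Type*) [Group G] [Finite G]
    (hG : IsWeaklyTop G) :
    Group.IsNilpotent G ∧
      Nonempty ((∀ p : (Nat.card G).primeFactors, ∀ P : Sylow p G, ↥P) ≃* G) ∧
      ∀ (p : ℕ), p.Prime → ∀ P : Sylow p G, IsWeaklyTop (↥P) := by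
  have hnil : Group.IsNilpotent G := wt_nilpotent (Nat.card G) G rfl hG
  exact ⟨hnil, ((Group.isNilpotent_of_finite_tfae (G := G)).out 0 4 rfl rfl).1 hnil,
    fun p hp P => wt_sylow hG p hp P⟩
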